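/- Let (W,S) be the affine Coxeter system of type D̃_5: S = {0,1,2,3,4,5} with m(0,2) = m(1,2) = m(2,3) = m(3,4) = m(3,5) = 3 and all other pairs commuting (m = 2). Then the homology of the weighted complex C_*(W) is: H_0 ≅ R/(Φ_2); H_1 = 0; H_2 ≅ R/(Φ_4); H_3 ≅ R/(Φ_5); H_4 ≅ (R/(Φ_2))² ⊕ R/(Φ_4) ⊕ R/(Φ_6) ⊕ (R/(Φ_8))³; H_5 ≅ R; and H_k = 0 for all k ≥ 6. -/

import Mathlib

open Polynomial CoxeterSystem

set_option synthInstance.maxHeartbeats 1000000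
set_option maxHeartbeats 1000000

noncomputable section

/-- The ring `R = ℚ[q,q⁻¹]` of Laurent polynomials over `ℚ`. -/
abbrev R : Type := LaurentPolynomial ℚ

/-- The image of the `d`-th cyclotomic polynomial `Φ_d` in `R`. -/
def cyc (d : ℕ) : R := Polynomial.toLaurent (Polynomial.cyclotomic d ℚ)

/-- The `R`-module `R/(Φ_d)`. -/
abbrev CycQuot (d : ℕ) := R ⧸ Ideal.span {cyc d}

variable {B : Type*} [Fintype B] [LinearOrder B] {W : Type*} [Group W]
  {M : CoxeterMatrix B} (cs : CoxeterSystem M W)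

/-- The standard parabolic subgroup `W_σ` generated by `σ ⊆ S`. -/
def parabolic (σ : Finset B) : Subgroup W := Subgroup.closure (cs.simple '' σ)

/-- The Poincaré polynomial `W_σ(q) = Σ_{w ∈ W_σ} q^{ℓ(w)}` of the standard parabolic
subgroup `W_σ` (defined to be `0` if `W_σ` is infinite). -/
def poin (σ : Finset B) : ℚ[X] :=
  letI := Classical.dec ((parabolic cs σ : Set W).Finite)
  if h : (parabolic cs σ : Set W).Finite then ∑ w ∈ h.toFinset, X ^ cs.length w else 0

/-- The set of simplices `σ ∈ K_W` with `|σ| = k`, i.e. the subsets of `S` of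
cardinality `k` generating a finite standard parabolic subgroup. -/
abbrev KW (k : ℕ) := {σ : Finset B // σ.card = k ∧ (parabolic cs σ : Set W).Finite}

noncomputable instance (k : ℕ) : Fintype (KW cs k) := Fintype.ofFinite _

/-- The coefficient of `e_τ` in `∂ e_σ`: it is
`(−1)^{#{t ∈ σ : t < s}} · W_σ(q)/W_{σ∖{s}}(q)` if `τ = σ ∖ {s}` for some `s ∈ σ`,
and `0` otherwise. -/
def bcoeff (σ τ : Finset B) : R :=
  ∑ s ∈ σ, if τ = σ.erase s then
      (-1 : R) ^ (σ.filter (fun t => t < s)).card *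
        Polynomial.toLaurent (poin cs σ / poin cs τ)
    else 0

/-- The boundary map `∂ : C_{k+1} → C_k` of the weighted complex `C_*(W)`, where
`C_k = ⊕_{σ ∈ K_W, |σ| = k} R·e_σ`. -/
def bdry (k : ℕ) : (KW cs (k + 1) → R) →ₗ[R] (KW cs k → R) :=
  Matrix.mulVecLin (Matrix.of fun (τ : KW cs k) (σ : KW cs (k + 1)) => bcoeff cs σ.1 τ.1)

/-- The submodule of cycles in degree `k` of the weighted complex. -/
def cycles : (k : ℕ) → Submodule R (KW cs k → R)
  | 0 => ⊤
  | (k + 1) => LinearMap.ker (bdry cs k)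

/-- The `k`-th homology `H_k(C_*(W))` of the weighted complex: cycles modulo boundaries. -/
abbrev Hgy (k : ℕ) :=
  cycles cs k ⧸ Submodule.comap (cycles cs k).subtype (LinearMap.range (bdry cs k))

end

section Exchange

open Classical in
/-- The involution of `W × ZMod 2` attached to the simple reflection `s i`: it conjugates the first
coordinate by `s i` and flips the second one exactly at `s i`. -/
noncomputable def simpleFlip {B W : Type*} [Group W] {M : CoxeterMatrix B}
    (cs : CoxeterSystem M W) (i : B) : Function.End (W × ZMod 2) :=
  fun x => (cs.simple i * x.1 * cs.simple i, x.2 + if x.1 = cs.simple i then 1 else 0)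

variable {B W : Type*} [Group W] {M : CoxeterMatrix B} (cs : CoxeterSystem M W)

open Classical in
theorem simpleFlip_word (ω : List B) (t : W) (e : ZMod 2) :
    (ω.map (simpleFlip cs)).prod (t, e) =
      (cs.wordProd ω * t * (cs.wordProd ω)⁻¹, e + ((cs.rightInvSeq ω).count t : ZMod 2)) := by
  induction ω with
  | nil => simp [Function.End.one_def]
  | cons i ω ih =>
    rw [List.map_cons, List.prod_cons]
    change simpleFlip cs i ((ω.map (simpleFlip cs)).prod (t, e)) = _
    rw [ih]
    have key : cs.wordProd ω * t * (cs.wordProd ω)⁻¹ = cs.simple i ↔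
        (cs.wordProd ω)⁻¹ * cs.simple i * cs.wordProd ω = t := by
      constructor
      · intro h; rw [← h]; group
      · rintro rfl; group
    simp only [simpleFlip, CoxeterSystem.rightInvSeq, CoxeterSystem.wordProd_cons, mul_inv_rev,
      CoxeterSystem.inv_simple, List.count_cons, Prod.mk.injEq, beq_iff_eq]
    refine ⟨by group, ?_⟩
    simp only [key]
    split_ifs <;> simp [add_assoc]

theorem rightInvSeq_eq_leftInvSeq {ω : List B} (h : cs.wordProd ω = 1) :
    cs.rightInvSeq ω = cs.leftInvSeq ω := by
  refine List.ext_getElem (by simp) fun j h₁ h₂ => ?_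
  have h₃ := cs.wordProd_mul_getD_rightInvSeq ω j
  have h₄ := cs.getD_leftInvSeq_mul_wordProd ω j
  rw [h, one_mul, List.getD_eq_getElem _ _ h₁] at h₃
  rw [h, mul_one, List.getD_eq_getElem _ _ h₂] at h₄
  rw [h₃, h₄]

open Classical in
theorem even_count_rightInvSeq_alternatingWord (i i' : B) (t : W) :
    (((cs.rightInvSeq (alternatingWord i i' (2 * M i i'))).count t : ℕ) : ZMod 2) = 0 := by
  have hone : cs.wordProd (alternatingWord i i' (2 * M i i')) = 1 := by
    rw [cs.prod_alternatingWord_eq_mul_pow]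
    simp
  rw [rightInvSeq_eq_leftInvSeq cs hone]
  set l := cs.leftInvSeq (alternatingWord i i' (2 * M i i')) with hl
  have hlen : l.length = 2 * M i i' := by simp [hl]
  have hper : l.drop (M i i') = l.take (M i i') := by
    refine List.ext_getElem (by simp [hlen]; lia) fun k h₁ h₂ => ?_
    have hk : k < M i i' := by simp [hlen] at h₂; lia
    rw [List.getElem_drop, List.getElem_take]
    simp only [hl]
    rw [cs.getElem_leftInvSeq_alternatingWord _ _ _ _ (by lia),
      cs.getElem_leftInvSeq_alternatingWord _ _ _ _ (by lia),
      cs.prod_alternatingWord_eq_mul_pow, cs.prod_alternatingWord_eq_mul_pow,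
      show (2 * (M i i' + k) + 1) / 2 = M i i' + k by lia, show (2 * k + 1) / 2 = k by lia,
      pow_add]
    simp
  rw [← List.take_append_drop (M i i') l, List.count_append, hper, ← two_mul]
  push_cast
  rw [show (2 : ZMod 2) = 0 from rfl, zero_mul]

theorem simpleFlip_isLiftable : M.IsLiftable (simpleFlip cs) := by
  classical
  intro i i'
  have h : ∀ m : ℕ, (simpleFlip cs i * simpleFlip cs i') ^ m =
      ((alternatingWord i i' (2 * m)).map (simpleFlip cs)).prod := by
    intro m
    induction m with
    | zero => simp [alternatingWord]
    | succ m ih =>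
      rw [show 2 * (m + 1) = 2 * m + 1 + 1 by ring, alternatingWord_succ', alternatingWord_succ',
        if_neg (by simp), if_pos (by simp), List.map_cons, List.map_cons, List.prod_cons,
        List.prod_cons, ← ih, pow_succ', mul_assoc]
  rw [h]
  funext ⟨t, e⟩
  rw [simpleFlip_word, even_count_rightInvSeq_alternatingWord, cs.prod_alternatingWord_eq_mul_pow]
  simp [Function.End.one_def]

/-- The parity of the number of occurrences of `t` in the right inversion sequence of any word
for `w`. -/
noncomputable def invParity (w t : W) : ZMod 2 :=
  (cs.lift ⟨simpleFlip cs, simpleFlip_isLiftable cs⟩ w (t, 0)).2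

open Classical in
theorem invParity_wordProd (ω : List B) (t : W) :
    invParity cs (cs.wordProd ω) t = ((cs.rightInvSeq ω).count t : ZMod 2) := by
  have h : cs.lift ⟨simpleFlip cs, simpleFlip_isLiftable cs⟩ (cs.wordProd ω) =
      (ω.map (simpleFlip cs)).prod := by
    rw [CoxeterSystem.wordProd, map_list_prod, List.map_map]
    congr 2
    funext i
    simp
  rw [invParity, h, simpleFlip_word]
  simp

theorem mem_rightInvSeq_of_invParity_ne_zero {ω : List B} {t : W}
    (h : invParity cs (cs.wordProd ω) t ≠ 0) : t ∈ cs.rightInvSeq ω := by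
  classical
  by_contra hn
  rw [invParity_wordProd, List.count_eq_zero_of_not_mem hn] at h
  simp at h

theorem invParity_of_nodup {ω : List B} {t : W} (hω : (cs.rightInvSeq ω).Nodup)
    (ht : t ∈ cs.rightInvSeq ω) : invParity cs (cs.wordProd ω) t = 1 := by
  classical
  rw [invParity_wordProd, List.count_eq_one_of_mem hω ht]
  simp

/-- A word with pairwise distinct right inversions is reduced. -/
theorem isReduced_of_nodup {ω : List B} (hω : (cs.rightInvSeq ω).Nodup) : cs.IsReduced ω := by
  classical
  obtain ⟨ω', h', he⟩ := cs.exists_isReduced (cs.wordProd ω)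
  have hsub : (cs.rightInvSeq ω).toFinset ⊆ (cs.rightInvSeq ω').toFinset := by
    intro t ht
    rw [List.mem_toFinset] at ht ⊢
    apply mem_rightInvSeq_of_invParity_ne_zero
    rw [← he, invParity_of_nodup cs hω ht]
    exact one_ne_zero
  have hle := (Finset.card_le_card hsub).trans (List.toFinset_card_le _)
  rw [List.toFinset_card_of_nodup hω, cs.length_rightInvSeq, cs.length_rightInvSeq] at hle
  refine le_antisymm (cs.length_wordProd_le ω) ?_
  rw [he, h'.eq]
  exact hle

theorem invParity_mul_simple_self (w : W) (i : B) :
    invParity cs (w * cs.simple i) (cs.simple i) = invParity cs w (cs.simple i) + 1 := by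
  classical
  obtain ⟨ω, rfl⟩ := cs.wordProd_surjective w
  rw [← cs.wordProd_concat, invParity_wordProd, invParity_wordProd, cs.rightInvSeq_concat,
    List.concat_eq_append, List.count_append]
  have : List.count (cs.simple i) ((cs.rightInvSeq ω).map (MulAut.conj (cs.simple i))) =
      List.count (cs.simple i) (cs.rightInvSeq ω) := by
    have := List.count_map_of_injective (cs.rightInvSeq ω) (MulAut.conj (cs.simple i))
      (MulAut.conj (cs.simple i)).injective (cs.simple i)
    simpa using this
  rw [this]
  simp

/-- Exchange property: if `s i` is a right descent of the product of `ω`, then `s i` occurs in the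
right inversion sequence of `ω`. -/
theorem simple_mem_rightInvSeq_of_lt {ω : List B} {i : B}
    (h : cs.length (cs.wordProd ω * cs.simple i) < cs.length (cs.wordProd ω)) :
    cs.simple i ∈ cs.rightInvSeq ω := by
  apply mem_rightInvSeq_of_invParity_ne_zero
  intro h0
  obtain ⟨ω', hr, he⟩ := cs.exists_isReduced (cs.wordProd ω * cs.simple i)
  have h1 : invParity cs (cs.wordProd ω') (cs.simple i) ≠ 0 := by
    rw [← he, invParity_mul_simple_self, h0]
    simp
  have h2 := (cs.isRightInversion_of_mem_rightInvSeq hr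
    (mem_rightInvSeq_of_invParity_ne_zero cs h1)).2
  rw [← he, cs.simple_mul_simple_cancel_right] at h2
  exact absurd h (not_lt.mpr h2.le)

theorem length_lt_mul_simple_of_not_mem {ω : List B} {i : B}
    (h : cs.simple i ∉ cs.rightInvSeq ω) :
    cs.length (cs.wordProd ω) < cs.length (cs.wordProd ω * cs.simple i) := by
  rcases lt_or_ge (cs.length (cs.wordProd ω * cs.simple i)) (cs.length (cs.wordProd ω)) with h' | h'
  · exact absurd (simple_mem_rightInvSeq_of_lt cs h') h
  · exact lt_of_le_of_ne h' (Ne.symm (cs.length_mul_simple_ne _ i))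

end Exchange

section Cosets

variable {B : Type*} {W : Type*} [Group W]
  {M : CoxeterMatrix B} (cs : CoxeterSystem M W)

theorem wordProd_mem_parabolic {σ : Finset B} {ω : List B} (h : ∀ i ∈ ω, i ∈ σ) :
    cs.wordProd ω ∈ parabolic cs σ := by
  induction ω with
  | nil => simp [one_mem]
  | cons i ω ih =>
    rw [cs.wordProd_cons]
    exact mul_mem (Subgroup.subset_closure ⟨i, h i (by simp), rfl⟩)
      (ih fun j hj => h j (by simp [hj]))

theorem exists_word_of_mem_parabolic {σ : Finset B} {w : W} (h : w ∈ parabolic cs σ) :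
    ∃ ω : List B, (∀ i ∈ ω, i ∈ σ) ∧ cs.wordProd ω = w := by
  induction h using Subgroup.closure_induction with
  | mem x hx =>
    obtain ⟨i, hi, rfl⟩ := hx
    exact ⟨[i], by simpa using hi, by simp⟩
  | one => exact ⟨[], by simp, by simp⟩
  | mul x y _ _ hx hy =>
    obtain ⟨a, ha, rfl⟩ := hx
    obtain ⟨b, hb, rfl⟩ := hy
    refine ⟨a ++ b, ?_, cs.wordProd_append a b⟩
    intro i hi
    rcases List.mem_append.mp hi with h | h
    exacts [ha i h, hb i h]
  | inv x _ hx =>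
    obtain ⟨a, ha, rfl⟩ := hx
    exact ⟨a.reverse, by simpa using ha, by simp⟩

theorem exists_shortest_word_of_mem_parabolic {σ : Finset B} {w : W} (h : w ∈ parabolic cs σ) :
    ∃ ω : List B, (∀ i ∈ ω, i ∈ σ) ∧ cs.wordProd ω = w ∧
      ∀ ω' : List B, (∀ i ∈ ω', i ∈ σ) → cs.wordProd ω' = w → ω.length ≤ ω'.length := by
  classical
  have hex : ∃ n, ∃ ω : List B, ω.length = n ∧ (∀ i ∈ ω, i ∈ σ) ∧ cs.wordProd ω = w := by
    obtain ⟨ω, h1, h2⟩ := exists_word_of_mem_parabolic cs h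
    exact ⟨_, ω, rfl, h1, h2⟩
  obtain ⟨ω, h1, h2, h3⟩ := Nat.find_spec hex
  exact ⟨ω, h2, h3, fun ω' h4 h5 => h1 ▸ Nat.find_min' hex ⟨ω', rfl, h4, h5⟩⟩

/-- Lengths add on a coset `d W_τ` when `d` has minimal length in it. -/
theorem length_mul_wordProd_of_minimal {τ : Finset B} {d : W}
    (hd : ∀ v ∈ parabolic cs τ, cs.length d ≤ cs.length (d * v)) (ω : List B)
    (hω : ∀ i ∈ ω, i ∈ τ)
    (hmin : ∀ ω' : List B, (∀ i ∈ ω', i ∈ τ) → cs.wordProd ω' = cs.wordProd ω →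
      ω.length ≤ ω'.length) :
    cs.length (d * cs.wordProd ω) = cs.length d + ω.length := by
  induction ω using List.reverseRecOn with
  | nil => simp
  | append_singleton ω t ih =>
    have hω' : ∀ i ∈ ω, i ∈ τ := fun i hi => hω i (by simp [hi])
    have ht : t ∈ τ := hω t (by simp)
    have ih := ih hω' fun ω' h1 h2 => by
      have := hmin (ω' ++ [t])
        (fun i hi => by
          rcases List.mem_append.mp hi with h | h
          · exact h1 i h
          · rw [List.mem_singleton.mp h]; exact ht)
        (by rw [cs.wordProd_append, cs.wordProd_append, h2])
      simpa using this
    rw [cs.wordProd_append, cs.wordProd_singleton, ← mul_assoc, List.length_append,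
      List.length_singleton, ← add_assoc, ← ih]
    rcases cs.length_mul_simple (d * cs.wordProd ω) t with h | h
    · exact h
    exfalso
    obtain ⟨δ, hδ, rfl⟩ := cs.exists_isReduced d
    rw [← cs.wordProd_append] at h
    have hmem := simple_mem_rightInvSeq_of_lt cs (ω := δ ++ ω) (i := t) (by lia)
    obtain ⟨j, hj, hjt⟩ := List.mem_iff_getElem.mp hmem
    have hdel := cs.wordProd_mul_getD_rightInvSeq (δ ++ ω) j
    rw [List.getD_eq_getElem _ _ hj, hjt] at hdel
    rw [cs.length_rightInvSeq, List.length_append] at hj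
    rcases lt_or_ge j δ.length with hlt | hge
    · rw [List.eraseIdx_append_of_lt_length hlt, cs.wordProd_append, cs.wordProd_append] at hdel
      have hv : (cs.wordProd ω * cs.simple t * (cs.wordProd ω)⁻¹) ∈ parabolic cs τ := by
        have h1 := wordProd_mem_parabolic cs hω'
        exact mul_mem (mul_mem h1 (Subgroup.subset_closure ⟨t, ht, rfl⟩)) (inv_mem h1)
      have h2 := hd _ hv
      have h3 : cs.wordProd δ * (cs.wordProd ω * cs.simple t * (cs.wordProd ω)⁻¹) =
          cs.wordProd (δ.eraseIdx j) := by
        rw [← mul_assoc, ← mul_assoc, hdel]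
        group
      rw [h3, hδ.eq] at h2
      have h4 := cs.length_wordProd_le (δ.eraseIdx j)
      rw [List.length_eraseIdx_of_lt hlt] at h4
      lia
    · rw [List.eraseIdx_append_of_length_le hge, cs.wordProd_append, cs.wordProd_append,
        mul_assoc, mul_left_cancel_iff] at hdel
      have h1 := hmin (ω.eraseIdx (j - δ.length))
        (fun i hi => hω' i (List.mem_of_mem_eraseIdx hi))
        (by rw [cs.wordProd_append, cs.wordProd_singleton, hdel])
      rw [List.length_eraseIdx_of_lt (by lia), List.length_append, List.length_singleton] at h1
      lia

/-- Lengths add on a coset `d W_τ` when no generator in `τ` is a right descent of `d`. -/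
theorem length_mul_of_forall_lt {τ : Finset B} {d : W}
    (hd : ∀ t ∈ τ, cs.length d < cs.length (d * cs.simple t)) {v : W} (hv : v ∈ parabolic cs τ) :
    cs.length (d * v) = cs.length d + cs.length v := by
  classical
  have hex : ∃ n, ∃ u ∈ parabolic cs τ, cs.length (d * u) = n := ⟨_, 1, one_mem _, rfl⟩
  obtain ⟨u, hu, hun⟩ := Nat.find_spec hex
  have hmin : ∀ x ∈ parabolic cs τ, cs.length (d * u) ≤ cs.length (d * u * x) := fun x hx =>
    hun ▸ Nat.find_min' hex ⟨u * x, mul_mem hu hx, by rw [mul_assoc]⟩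
  obtain ⟨ω, h1, h2, h3⟩ := exists_shortest_word_of_mem_parabolic cs (inv_mem hu)
  have hdω : d = d * u * cs.wordProd ω := by rw [h2]; group
  have hlen := length_mul_wordProd_of_minimal cs hmin ω h1 (by rw [h2]; exact h3)
  rw [← hdω] at hlen
  have hnil : ω = [] := by
    rcases List.eq_nil_or_concat ω with h | ⟨ω', t, rfl⟩
    · exact h
    exfalso
    have h4 := hd t (h1 t (by simp))
    have h5 : d * cs.simple t = d * u * cs.wordProd ω' := by
      conv_lhs => rw [hdω, cs.wordProd_concat]
      rw [← mul_assoc, cs.simple_mul_simple_cancel_right]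
    have h6 := cs.length_mul_le (d * u) (cs.wordProd ω')
    have h7 := cs.length_wordProd_le ω'
    rw [← h5] at h6
    rw [List.length_concat] at hlen
    lia
  have hdu : d * u = d := by
    rw [hnil] at hdω
    simpa using hdω.symm
  rw [hdu] at hmin
  have hadd : ∀ x : W, (∀ y ∈ parabolic cs τ, cs.length x ≤ cs.length (x * y)) →
      ∃ n, cs.length (x * v) = cs.length x + n ∧ ∃ ω : List B, cs.wordProd ω = v ∧
        (∀ i ∈ ω, i ∈ τ) ∧ (∀ ω' : List B, (∀ i ∈ ω', i ∈ τ) → cs.wordProd ω' = v →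
          ω.length ≤ ω'.length) ∧ n = ω.length := by
    intro x hx
    obtain ⟨ω, h1, h2, h3⟩ := exists_shortest_word_of_mem_parabolic cs hv
    refine ⟨ω.length, ?_, ω, h2, h1, h3, rfl⟩
    rw [← h2]
    exact length_mul_wordProd_of_minimal cs hx ω h1 (by rw [h2]; exact h3)
  obtain ⟨n, hn, a, ha, haτ, ha', rfl⟩ := hadd d hmin
  obtain ⟨m, hm, b, hb, hbτ, hb', rfl⟩ := hadd 1 (by simp)
  have hab : a.length = b.length := le_antisymm (ha' b hbτ hb) (hb' a haτ ha)
  simp only [one_mul, cs.length_one, zero_add] at hm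
  rw [hn, hm, hab]

theorem poin_of_finite {σ : Finset B} (h : (parabolic cs σ : Set W).Finite) :
    poin cs σ = ∑ w ∈ h.toFinset, (X : ℚ[X]) ^ cs.length w := by
  rw [poin, dif_pos h]

/-- If the words in `D` represent the minimal coset representatives of `W_σ / W_τ`, then the
Poincaré polynomial of `W_σ` is that of `W_τ` times the length generating function of `D`. -/
theorem finite_and_poin_eq_mul {σ τ : Finset B} (hτσ : τ ⊆ σ)
    (hfin : (parabolic cs τ : Set W).Finite) (D : List (List B))
    (hDσ : ∀ d ∈ D, ∀ i ∈ d, i ∈ σ) (hnil : [] ∈ D)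
    (hclosed : ∀ d ∈ D, ∀ t ∈ σ, (∃ d' ∈ D, cs.simple t * cs.wordProd d = cs.wordProd d') ∨
      ∃ t' ∈ τ, cs.simple t * cs.wordProd d = cs.wordProd d * cs.simple t')
    (hmin : ∀ d ∈ D, ∀ t ∈ τ, cs.length (cs.wordProd d) < cs.length (cs.wordProd d * cs.simple t))
    (hred : ∀ d ∈ D, cs.IsReduced d) (hinj : (D.map cs.wordProd).Nodup) :
    (parabolic cs σ : Set W).Finite ∧
      poin cs σ = poin cs τ * (D.map fun d => (X : ℚ[X]) ^ d.length).sum := by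
  classical
  have hle : parabolic cs τ ≤ parabolic cs σ :=
    Subgroup.closure_mono (Set.image_mono (by exact_mod_cast hτσ))
  have hcover : ∀ w ∈ parabolic cs σ, ∃ d ∈ D, ∃ v ∈ parabolic cs τ, cs.wordProd d * v = w := by
    intro w hw
    obtain ⟨ω, hω, rfl⟩ := exists_word_of_mem_parabolic cs hw
    clear hw
    induction ω with
    | nil => exact ⟨[], hnil, 1, one_mem _, by simp⟩
    | cons t ω ih =>
      obtain ⟨d, hd, v, hv, he⟩ := ih fun i hi => hω i (by simp [hi])
      rw [cs.wordProd_cons, ← he, ← mul_assoc]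
      rcases hclosed d hd t (hω t (by simp)) with ⟨d', hd', h⟩ | ⟨t', ht', h⟩
      · exact ⟨d', hd', v, hv, by rw [h]⟩
      · exact ⟨d, hd, cs.simple t' * v, mul_mem (Subgroup.subset_closure ⟨t', ht', rfl⟩) hv,
          by rw [h, mul_assoc]⟩
  set E : Finset W := (D.map cs.wordProd).toFinset with hE
  have hmemE : ∀ x, x ∈ E ↔ ∃ d ∈ D, cs.wordProd d = x := by simp [hE]
  have hfinσ : (parabolic cs σ : Set W).Finite := by
    refine ((E ×ˢ hfin.toFinset).finite_toSet.image fun p : W × W => p.1 * p.2).subset ?_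
    intro w hw
    obtain ⟨d, hd, v, hv, he⟩ := hcover w hw
    exact ⟨(cs.wordProd d, v), by simpa [hmemE] using ⟨⟨d, hd, rfl⟩, hv⟩, he⟩
  refine ⟨hfinσ, ?_⟩
  have hsumE : (D.map fun d => (X : ℚ[X]) ^ d.length).sum = ∑ x ∈ E, X ^ cs.length x := by
    rw [hE, List.sum_toFinset _ hinj, List.map_map]
    refine congrArg List.sum (List.map_congr_left fun d hd => ?_)
    simp [(hred d hd).eq]
  rw [poin_of_finite cs hfinσ, poin_of_finite cs hfin, hsumE, mul_comm, Finset.sum_mul_sum,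
    ← Finset.sum_product']
  have hadd : ∀ d ∈ D, ∀ v ∈ parabolic cs τ,
      cs.length (cs.wordProd d * v) = cs.length (cs.wordProd d) + cs.length v :=
    fun d hd v hv => length_mul_of_forall_lt cs (hmin d hd) hv
  symm
  refine Finset.sum_bij (fun p _ => p.1 * p.2) ?_ ?_ ?_ ?_
  · rintro ⟨x, v⟩ hp
    simp only [Finset.mem_product, hmemE, Set.Finite.mem_toFinset, SetLike.mem_coe] at hp ⊢
    obtain ⟨⟨d, hd, rfl⟩, hv⟩ := hp
    exact mul_mem (wordProd_mem_parabolic cs (hDσ d hd)) (hle hv)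
  · rintro ⟨x, v⟩ hp ⟨y, u⟩ hq h
    simp only [Finset.mem_product, hmemE, Set.Finite.mem_toFinset, SetLike.mem_coe] at hp hq h
    obtain ⟨⟨d, hd, rfl⟩, hv⟩ := hp
    obtain ⟨⟨e, he, rfl⟩, hu⟩ := hq
    have h1 : cs.wordProd e = cs.wordProd d * (v * u⁻¹) := by rw [← mul_assoc, h]; group
    have h2 : cs.wordProd d = cs.wordProd e * (v * u⁻¹)⁻¹ := by rw [h1]; group
    have hvu := mul_mem hv (inv_mem hu)
    have h3 := hadd d hd _ hvu
    have h4 := hadd e he _ (inv_mem hvu)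
    rw [← h1] at h3
    rw [← h2] at h4
    have h5 : v * u⁻¹ = 1 := by
      rw [← cs.length_eq_zero_iff]
      lia
    rw [h5, mul_one] at h1
    rw [mul_inv_eq_one.mp h5, h1]
  · intro w hw
    simp only [Set.Finite.mem_toFinset, SetLike.mem_coe] at hw
    obtain ⟨d, hd, v, hv, he⟩ := hcover w hw
    exact ⟨(cs.wordProd d, v), by simpa [hmemE] using ⟨⟨d, hd, rfl⟩, hv⟩, he⟩
  · rintro ⟨x, v⟩ hp
    simp only [Finset.mem_product, hmemE, Set.Finite.mem_toFinset, SetLike.mem_coe] at hp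
    obtain ⟨⟨d, hd, rfl⟩, hv⟩ := hp
    rw [hadd d hd v hv, pow_add]

end Cosets

section NumbersGame

/-- The edges of the Coxeter graph of type `D̃₅`. -/
def edge (i j : Fin 6) : Bool :=
  (i.val, j.val) ∈ ([(0, 2), (1, 2), (2, 3), (3, 4), (3, 5), (2, 0), (2, 1), (3, 2), (4, 3), (5, 3)] :
    List (ℕ × ℕ))

/-- Integer labellings of the nodes of the Coxeter graph of type `D̃₅`. -/
abbrev Labelling := ℤ × ℤ × ℤ × ℤ × ℤ × ℤ

/-- A move of the numbers game: negate the label of `i` and add its old value to the neighbours. -/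
def fire : Fin 6 → Labelling → Labelling
  | 0, (a, b, c, d, e, f) => (-a, b, c + a, d, e, f)
  | 1, (a, b, c, d, e, f) => (a, -b, c + b, d, e, f)
  | 2, (a, b, c, d, e, f) => (a + c, b + c, -c, d + c, e, f)
  | 3, (a, b, c, d, e, f) => (a, b, c + d, -d, e + d, f + d)
  | 4, (a, b, c, d, e, f) => (a, b, c, d + e, -e, f)
  | 5, (a, b, c, d, e, f) => (a, b, c, d + f, e, -f)

/-- The result of playing a word, starting with its last letter. -/
def play (ω : List (Fin 6)) (v : Labelling) : Labelling := ω.foldr fire v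

/-- The Coxeter matrix `Mat` has type `D̃₅`. -/
def IsAffineD5 (Mat : CoxeterMatrix (Fin 6)) : Prop :=
  ∀ i j, Mat.M i j = if i = j then 1 else if edge i j then 3 else 2

theorem isAffineD5_of_lt {Mat : CoxeterMatrix (Fin 6)} (hM : ∀ i j : Fin 6, i.val < j.val →
      Mat.M i j = (if (i.val, j.val) ∈ ([(0, 2), (1, 2), (2, 3), (3, 4), (3, 5)] : List (ℕ × ℕ))
        then 3 else 2)) : IsAffineD5 Mat := by
  have key : ∀ i j : Fin 6, i.val < j.val →
      (if (i.val, j.val) ∈ ([(0, 2), (1, 2), (2, 3), (3, 4), (3, 5)] : List (ℕ × ℕ)) then 3 else 2)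
        = (if i = j then 1 else if edge i j then 3 else 2) := by decide
  have hsymm : ∀ i j : Fin 6, (if i = j then 1 else if edge i j then 3 else 2)
        = (if j = i then 1 else if edge j i then 3 else 2) := by decide
  intro i j
  rcases lt_trichotomy i.val j.val with h | h | h
  · rw [hM i j h, key i j h]
  · obtain rfl := Fin.ext h
    simp
  · rw [Mat.symmetric i j, hM j i h, key j i h, hsymm]

variable {W : Type*} [Group W] {Mat : CoxeterMatrix (Fin 6)} (cs : CoxeterSystem Mat W)

/-- The moves of the numbers game as elements of the monoid of all self-maps of labellings. -/
def fireEnd (i : Fin 6) : Function.End Labelling := fire i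

theorem isLiftable_fireEnd (h : IsAffineD5 Mat) : Mat.IsLiftable fireEnd := by
  have h1 : ∀ i v, fire i (fire i v) = v := by
    rintro i ⟨a, b, c, d, e, f⟩
    fin_cases i <;> simp [fire]
  have h2 : ∀ i j, i ≠ j → edge i j = false → ∀ v, fire i (fire j v) = fire j (fire i v) := by
    rintro i j hne he ⟨a, b, c, d, e, f⟩
    fin_cases i <;> fin_cases j <;> simp [fire, edge, add_assoc] at hne he ⊢ <;> ring
  have h3 : ∀ i j, edge i j = true → ∀ v,
      fire i (fire j (fire i v)) = fire j (fire i (fire j v)) := by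
    rintro i j he ⟨a, b, c, d, e, f⟩
    fin_cases i <;> fin_cases j <;> simp [fire, edge] at he ⊢ <;>
      constructorm* _ ∧ _ <;> ring
  intro i j
  have hij : Mat.M i j = if i = j then 1 else if edge i j then 3 else 2 := h i j
  funext v
  rw [hij]
  split_ifs with he hed
  · subst he
    rw [pow_one]
    exact h1 i v
  · show fire i (fire j (fire i (fire j (fire i (fire j v))))) = v
    rw [h3 i j hed, h1, h1, h1]
  · rw [pow_two]
    show fire i (fire j (fire i (fire j v))) = v
    rw [h2 i j he (by simpa using hed), h1, h1]

theorem exists_numbersGame_action (h : IsAffineD5 Mat) :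
    ∃ ρ : W →* Function.End Labelling, ∀ ω, ρ (cs.wordProd ω) = play ω := by
  have hl := isLiftable_fireEnd h
  refine ⟨cs.lift ⟨_, hl⟩, fun ω => ?_⟩
  induction ω with
  | nil => simp; rfl
  | cons i ω ih =>
    rw [cs.wordProd_cons, map_mul, ih, cs.lift_apply_simple hl i]
    rfl

theorem wordProd_ne_of_play_ne (h : IsAffineD5 Mat) {ω ω' : List (Fin 6)} (v : Labelling)
    (hne : play ω v ≠ play ω' v) : cs.wordProd ω ≠ cs.wordProd ω' := by
  obtain ⟨ρ, hρ⟩ := exists_numbersGame_action cs h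
  intro e
  exact hne (by rw [← hρ, ← hρ, e])

theorem infinite_parabolic_univ (h : IsAffineD5 Mat) :
    ¬ (parabolic cs (Finset.univ : Finset (Fin 6)) : Set W).Finite := by
  obtain ⟨ρ, hρ⟩ := exists_numbersGame_action cs h
  let ω : List (Fin 6) := [0, 2, 3, 5, 4, 3, 2, 1, 2, 3, 4, 5, 3, 2]
  have hpow : ∀ n : ℕ, ρ (cs.wordProd ω ^ n) (1, 1, 1, 1, 1, 1) =
      (1 - 16 * (n : ℤ), 1, 1 + 8 * (n : ℤ), 1, 1, 1) := by
    intro n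
    induction n with
    | zero => simp [Function.End.one_def]
    | succ n ih =>
      rw [pow_succ', map_mul]
      show ρ (cs.wordProd ω) (ρ (cs.wordProd ω ^ n) _) = _
      rw [ih, hρ]
      simp only [play, ω, List.foldr, fire, Prod.mk.injEq]
      push_cast
      refine ⟨?_, ?_, ?_, ?_, ?_, ?_⟩ <;> ring
  intro hfin
  refine Set.infinite_of_injective_forall_mem (f := fun n : ℕ => cs.wordProd ω ^ n) ?_ ?_ hfin
  · intro m n hmn
    have := congrArg (fun w => (ρ w (1, 1, 1, 1, 1, 1)).1) hmn
    simp only [hpow] at this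
    lia
  · exact fun n => pow_mem (wordProd_mem_parabolic cs fun i _ => Finset.mem_univ i) n

theorem simple_mul_comm_of_not_edge (h : IsAffineD5 Mat) {i j : Fin 6} (hij : i ≠ j)
    (he : edge i j = false) : cs.simple i * cs.simple j = cs.simple j * cs.simple i := by
  have := cs.simple_mul_simple_pow i j
  have hm : Mat i j = 2 := by simpa [hij, he] using h i j
  rw [hm, pow_two, mul_eq_one_iff_eq_inv] at this
  simpa using this

theorem simple_braid_of_edge (h : IsAffineD5 Mat) {i j : Fin 6} (hij : i ≠ j)
    (he : edge i j = true) :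
    cs.simple i * cs.simple j * cs.simple i = cs.simple j * cs.simple i * cs.simple j := by
  have := cs.simple_mul_simple_pow i j
  have hm : Mat i j = 3 := by simpa [hij, he] using h i j
  have h3 : (cs.simple i * cs.simple j) ^ 3 =
      (cs.simple i * cs.simple j * cs.simple i) * (cs.simple j * cs.simple i * cs.simple j) := by
    simp only [pow_three, mul_assoc]
  rw [hm, h3, mul_eq_one_iff_eq_inv] at this
  simpa [mul_assoc] using this

end NumbersGame

section CosetRepresentatives

/-- The elements of a set of nodes in increasing order. -/
def nodes (σ : Finset (Fin 6)) : List (Fin 6) := (List.finRange 6).filter (· ∈ σ)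

/-- The node whose removal from `σ` gives the parabolic subgroup whose cosets are enumerated. -/
def removed (σ : Finset (Fin 6)) : Fin 6 :=
  if {2, 3, 4, 5} ⊂ σ then (nodes σ).headD 0 else (nodes σ).getLastD 0

/-- If `push n t d = some t'` then `s t * π d = π d * s t'`. -/
def push : ℕ → Fin 6 → List (Fin 6) → Option (Fin 6)
  | 0, _, _ => none
  | _ + 1, t, [] => some t
  | n + 1, t, y :: r =>
    if t = y then none
    else if edge t y = false then push n t r
    else match r with
      | [] => none
      | z :: r =>
        if z = t then push n y r
        else match r with
          | [] => none
          | u :: r => if u = t ∧ edge z t = false then push n y (z :: r) else none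

/-- A sufficient criterion for `s t * π d` to be represented by an element of `D`. -/
def reaches (D : List (List (Fin 6))) (t : Fin 6) (d : List (Fin 6)) : Bool :=
  (t :: d) ∈ D || match d with
    | [] => false
    | y :: r =>
      (t = y && r ∈ D) || (t ≠ y && edge t y = false && ((y :: t :: r) ∈ D || match r with
        | [] => false
        | u :: r => u = t && (y :: r) ∈ D))

/-- One step of a breadth-first enumeration of the left cosets of `W_τ` in `W_σ`. -/
def enlarge (σ τ : Finset (Fin 6)) (D level : List (List (Fin 6))) : List (List (Fin 6)) :=
  level.foldl (fun new d => (nodes σ).foldl (fun new t =>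
    if (push 12 t d).any (· ∈ τ) || reaches (D ++ new) t d then new else new ++ [t :: d]) new) []

/-- Breadth-first enumeration of minimal representatives of the left cosets of `W_τ` in `W_σ`. -/
def enumerate (σ τ : Finset (Fin 6)) : ℕ → List (List (Fin 6)) → List (List (Fin 6)) →
    List (List (Fin 6))
  | 0, D, _ => D
  | _ + 1, D, [] => D
  | n + 1, D, d :: l =>
    let new := enlarge σ τ D (d :: l)
    enumerate σ τ n (D ++ new) new

/-- Minimal representatives of the left cosets in `W_σ` of the subgroup generated by all nodes
except `removed σ`. -/
def reps (σ : Finset (Fin 6)) : List (List (Fin 6)) :=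
  enumerate σ (σ.erase (removed σ)) 12 [[]] [[]]

/-- Words for the elements of the right inversion sequence. -/
def inversionWords : List (Fin 6) → List (List (Fin 6))
  | [] => []
  | i :: ω => (ω.reverse ++ i :: ω) :: inversionWords ω

/-- The starting position of the numbers game with all labels equal to `1`. -/
def ones : Labelling := (1, 1, 1, 1, 1, 1)

/-- The conditions on `D` that make it a list of reduced words for the minimal representatives of
the left cosets in `W_σ` of the subgroup generated by all nodes except `i`. -/
structure IsTransversal (σ : Finset (Fin 6)) (i : Fin 6) (D : List (List (Fin 6))) : Prop where
  mem : i ∈ σ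
  nil_mem : [] ∈ D
  letters : ∀ d ∈ D, ∀ t ∈ d, t ∈ σ
  closed : ∀ d ∈ D, ∀ t ∈ σ, reaches D t d ∨ (push 12 t d).any (· ∈ σ.erase i)
  reduced : ∀ d ∈ D, ((inversionWords d).map (play · ones)).Nodup
  minimal : ∀ d ∈ D, ∀ t ∈ σ.erase i, play [t] ones ∉ (inversionWords d).map (play · ones)
  distinct : (D.map (play · ones)).Nodup

instance (σ i D) : Decidable (IsTransversal σ i D) :=
  decidable_of_iff ((decide (i ∈ σ) && decide ([] ∈ D) && decide (∀ d ∈ D, ∀ t ∈ d, t ∈ σ) &&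
    decide (∀ d ∈ D, ∀ t ∈ σ, reaches D t d ∨ (push 12 t d).any (· ∈ σ.erase i)) &&
    decide (∀ d ∈ D, ((inversionWords d).map (play · ones)).Nodup) &&
    decide (∀ d ∈ D, ∀ t ∈ σ.erase i, play [t] ones ∉ (inversionWords d).map (play · ones)) &&
    decide ((D.map (play · ones)).Nodup)) = true) (by
      simp only [Bool.and_eq_true, decide_eq_true_eq]
      exact ⟨fun ⟨⟨⟨⟨⟨⟨h1, h2⟩, h3⟩, h4⟩, h5⟩, h6⟩, h7⟩ => ⟨h1, h2, h3, h4, h5, h6, h7⟩,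
        fun ⟨h1, h2, h3, h4, h5, h6, h7⟩ => ⟨⟨⟨⟨⟨⟨h1, h2⟩, h3⟩, h4⟩, h5⟩, h6⟩, h7⟩⟩)

theorem isTransversal_reps : ∀ σ : Finset (Fin 6), σ ≠ ∅ → σ ≠ Finset.univ →
    IsTransversal σ (removed σ) (reps σ) := by
  decide +kernel

variable {W : Type*} [Group W] {Mat : CoxeterMatrix (Fin 6)} (cs : CoxeterSystem Mat W)

theorem simple_mul_comm (h : IsAffineD5 Mat) {i j : Fin 6} (he : edge i j = false) :
    cs.simple i * cs.simple j = cs.simple j * cs.simple i := by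
  rcases eq_or_ne i j with rfl | hij
  · rfl
  · exact simple_mul_comm_of_not_edge cs h hij he

theorem simple_braid (h : IsAffineD5 Mat) {i j : Fin 6} (he : edge i j ≠ false) :
    cs.simple i * cs.simple j * cs.simple i = cs.simple j * cs.simple i * cs.simple j := by
  rcases eq_or_ne i j with rfl | hij
  · rfl
  · exact simple_braid_of_edge cs h hij (by simpa using he)

theorem simple_mul_wordProd_of_push (h : IsAffineD5 Mat) {n : ℕ} {t t' : Fin 6}
    {d : List (Fin 6)} (hp : push n t d = some t') :
    cs.simple t * cs.wordProd d = cs.wordProd d * cs.simple t' := by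
  induction n generalizing t d with
  | zero => simp [push] at hp
  | succ n ih =>
    match d with
    | [] =>
      obtain rfl : t = t' := by simpa [push] using hp
      simp
    | y :: r =>
      rw [push.eq_def] at hp
      dsimp only at hp
      split_ifs at hp with h1 h2
      · rw [cs.wordProd_cons, ← mul_assoc, simple_mul_comm cs h h2, mul_assoc, ih hp, mul_assoc]
      · match r with
        | [] => simp at hp
        | z :: r =>
          dsimp only at hp
          split_ifs at hp with h3
          · subst h3
            rw [cs.wordProd_cons, cs.wordProd_cons, ← mul_assoc, ← mul_assoc,
              simple_braid cs h h2, mul_assoc, ih hp]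
            simp only [mul_assoc]
          · match r with
            | [] => simp at hp
            | u :: r =>
              dsimp only at hp
              split_ifs at hp with h4
              obtain ⟨rfl, h4⟩ := h4
              have hb := simple_braid cs h h2
              have hc := simple_mul_comm cs h h4
              have hr := ih hp
              simp only [cs.wordProd_cons] at hr ⊢
              calc _ = cs.simple u * cs.simple y * (cs.simple z * cs.simple u) * cs.wordProd r := by
                    simp only [mul_assoc]
                _ = cs.simple u * cs.simple y * cs.simple u * (cs.simple z * cs.wordProd r) := by
                    rw [hc]; simp only [mul_assoc]
                _ = cs.simple y * cs.simple u * (cs.simple y * (cs.simple z * cs.wordProd r)) := by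
                    rw [hb]; simp only [mul_assoc]
                _ = cs.simple y * (cs.simple u * cs.simple z) * cs.wordProd r * cs.simple t' := by
                    rw [hr]; simp only [mul_assoc]
                _ = _ := by rw [← hc]; simp only [mul_assoc]

theorem exists_wordProd_eq_of_reaches (h : IsAffineD5 Mat) {D : List (List (Fin 6))} {t : Fin 6}
    {d : List (Fin 6)} (hr : reaches D t d) :
    ∃ d' ∈ D, cs.simple t * cs.wordProd d = cs.wordProd d' := by
  unfold reaches at hr
  rcases (Bool.or_eq_true _ _).mp hr with hr | hr
  · exact ⟨_, by simpa using hr, (cs.wordProd_cons _ _).symm⟩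
  · match d with
    | [] => simp at hr
    | y :: r =>
      simp only [Bool.or_eq_true, Bool.and_eq_true, decide_eq_true_eq] at hr
      rcases hr with ⟨rfl, hr⟩ | ⟨⟨-, he⟩, hr | hr⟩
      · exact ⟨r, hr, by simp [cs.wordProd_cons]⟩
      · refine ⟨_, hr, ?_⟩
        simp only [cs.wordProd_cons, ← mul_assoc, simple_mul_comm cs h he]
      · match r with
        | [] => simp at hr
        | u :: r =>
          simp only [Bool.and_eq_true, decide_eq_true_eq] at hr
          obtain ⟨rfl, hr⟩ := hr
          refine ⟨_, hr, ?_⟩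
          rw [cs.wordProd_cons, cs.wordProd_cons, cs.wordProd_cons, ← mul_assoc,
            simple_mul_comm cs h he, mul_assoc, cs.simple_mul_simple_cancel_left]

theorem rightInvSeq_eq_map_inversionWords (ω : List (Fin 6)) :
    cs.rightInvSeq ω = (inversionWords ω).map cs.wordProd := by
  induction ω with
  | nil => rfl
  | cons i ω ih =>
    simp [inversionWords, ← ih, CoxeterSystem.rightInvSeq, cs.wordProd_append, cs.wordProd_cons, mul_assoc]

theorem nodup_map_wordProd (h : IsAffineD5 Mat) {D : List (List (Fin 6))} (v : Labelling)
    (hD : (D.map (play · v)).Nodup) : (D.map cs.wordProd).Nodup := by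
  rw [List.Nodup, List.pairwise_map] at hD ⊢
  exact hD.imp fun hne => wordProd_ne_of_play_ne cs h v hne

theorem IsTransversal.finite_and_poin_eq_mul (h : IsAffineD5 Mat) {σ : Finset (Fin 6)} {i : Fin 6}
    {D : List (List (Fin 6))} (hD : IsTransversal σ i D)
    (hfin : (parabolic cs (σ.erase i) : Set W).Finite) :
    (parabolic cs σ : Set W).Finite ∧
      poin cs σ = poin cs (σ.erase i) * (D.map fun d => X ^ d.length).sum := by
  refine _root_.finite_and_poin_eq_mul cs (Finset.erase_subset _ _) hfin D hD.letters hD.nil_mem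
    (fun d hd t ht => ?_) (fun d hd t ht => ?_) (fun d hd => ?_)
    (nodup_map_wordProd cs h ones hD.distinct)
  · rcases hD.closed d hd t ht with hr | hr
    · exact Or.inl (exists_wordProd_eq_of_reaches cs h hr)
    · obtain ⟨t', hp, ht'⟩ := Option.any_eq_true _ _ |>.mp hr
      exact Or.inr ⟨t', by simpa using ht', simple_mul_wordProd_of_push cs h hp⟩
  · refine length_lt_mul_simple_of_not_mem cs fun hmem => ?_
    rw [rightInvSeq_eq_map_inversionWords, List.mem_map] at hmem
    obtain ⟨ω, hω, e⟩ := hmem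
    refine wordProd_ne_of_play_ne cs h ones (ω := [t]) (ω' := ω) (fun hp => ?_) (by simp [e])
    exact hD.minimal d hd t ht (List.mem_map.mpr ⟨ω, hω, hp.symm⟩)
  · refine isReduced_of_nodup cs ?_
    rw [rightInvSeq_eq_map_inversionWords]
    exact nodup_map_wordProd cs h ones (hD.reduced d hd)

end CosetRepresentatives

section CoefficientLists

/-- The polynomial with the given list of coefficients, starting with the constant coefficient. -/
noncomputable def ofCoeffs : List ℤ → ℚ[X]
  | [] => 0
  | a :: l => (a : ℚ[X]) + X * ofCoeffs l

/-- Addition of coefficient lists. -/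
def addCoeffs : List ℤ → List ℤ → List ℤ
  | [], l => l
  | l, [] => l
  | a :: l, b :: m => (a + b) :: addCoeffs l m

/-- Multiplication of a coefficient list by an integer. -/
def smulCoeffs (a : ℤ) (l : List ℤ) : List ℤ := l.map (a * ·)

/-- Multiplication of coefficient lists. -/
def mulCoeffs : List ℤ → List ℤ → List ℤ
  | [], _ => []
  | [a], m => smulCoeffs a m
  | a :: l, m => addCoeffs (smulCoeffs a m) (0 :: mulCoeffs l m)

/-- Whether two coefficient lists give the same polynomial. -/
def eqCoeffs (l m : List ℤ) : Bool := (addCoeffs l (smulCoeffs (-1) m)).all (· = 0)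

/-- Power series division of coefficient lists, truncated after `n` terms, for a denominator with
constant coefficient `1`. -/
def divCoeffs : ℕ → List ℤ → List ℤ → List ℤ
  | 0, _, _ => []
  | n + 1, l, m =>
    let a := l.headD 0
    a :: divCoeffs n (addCoeffs l (smulCoeffs (-a) m)).tail m

@[simp] theorem ofCoeffs_nil : ofCoeffs [] = 0 := rfl

@[simp] theorem ofCoeffs_cons (a : ℤ) (l : List ℤ) :
    ofCoeffs (a :: l) = (a : ℚ[X]) + X * ofCoeffs l := rfl

@[simp] theorem ofCoeffs_add (l m : List ℤ) :
    ofCoeffs (addCoeffs l m) = ofCoeffs l + ofCoeffs m := by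
  induction l generalizing m with
  | nil => simp [addCoeffs]
  | cons a l ih =>
    cases m with
    | nil => simp [addCoeffs]
    | cons b m => simp only [addCoeffs, ofCoeffs_cons, ih]; push_cast; ring

@[simp] theorem ofCoeffs_smul (a : ℤ) (l : List ℤ) :
    ofCoeffs (smulCoeffs a l) = (a : ℚ[X]) * ofCoeffs l := by
  induction l with
  | nil => simp [smulCoeffs]
  | cons b l ih =>
    simp only [smulCoeffs, List.map_cons, ofCoeffs_cons] at ih ⊢
    rw [ih]; push_cast; ring

@[simp] theorem ofCoeffs_mul (l m : List ℤ) :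
    ofCoeffs (mulCoeffs l m) = ofCoeffs l * ofCoeffs m := by
  induction l with
  | nil => simp [mulCoeffs]
  | cons a l ih =>
    cases l with
    | nil => simp [mulCoeffs]
    | cons b l =>
      rw [mulCoeffs, ofCoeffs_add, ofCoeffs_smul, ofCoeffs_cons 0, ih, ofCoeffs_cons a]
      · push_cast; ring
      · simp

theorem ofCoeffs_eq_zero {l : List ℤ} (h : l.all (· = 0) = true) : ofCoeffs l = 0 := by
  induction l with
  | nil => rfl
  | cons a l ih =>
    simp only [List.all_cons, Bool.and_eq_true, decide_eq_true_eq] at h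
    simp [ih h.2, h.1]

theorem ofCoeffs_eq_of_eqCoeffs {l m : List ℤ} (h : eqCoeffs l m = true) :
    ofCoeffs l = ofCoeffs m := by
  have := ofCoeffs_eq_zero h
  simp only [ofCoeffs_add, ofCoeffs_smul] at this
  push_cast at this
  linear_combination this

theorem ofCoeffs_ne_zero {l : List ℤ} (h : l.headD 0 = 1) : ofCoeffs l ≠ 0 := by
  cases l with
  | nil => simp at h
  | cons a l =>
    simp only [List.headD_cons] at h
    subst h
    intro e
    have := congrArg (fun p => coeff p 0) e
    simp at this

theorem ofCoeffs_replicate_zero_append (k : ℕ) (l : List ℤ) :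
    ofCoeffs (List.replicate k 0 ++ l) = X ^ k * ofCoeffs l := by
  induction k with
  | zero => simp
  | succ k ih => simp [List.replicate_succ, ih, pow_succ', mul_assoc]

end CoefficientLists

section PoincarePolynomials

/-- The coefficients of the length generating function of the words in `D`. -/
def lengthCoeffs (D : List (List (Fin 6))) : List ℤ :=
  D.foldr (fun d l => addCoeffs (List.replicate d.length 0 ++ [1]) l) []

theorem ofCoeffs_lengthCoeffs (D : List (List (Fin 6))) :
    ofCoeffs (lengthCoeffs D) = (D.map fun d => X ^ d.length).sum := by
  induction D with
  | nil => rfl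
  | cons d D ih =>
    simp only [lengthCoeffs, List.foldr_cons, ofCoeffs_add, ofCoeffs_replicate_zero_append] at ih ⊢
    rw [ih]
    simp

/-- The coefficients of the Poincaré polynomial of `W_σ` if `σ` has at most `n` elements. -/
def poinCoeffs : ℕ → Finset (Fin 6) → List ℤ
  | 0, _ => [1]
  | n + 1, σ => if σ = ∅ then [1] else
      mulCoeffs (poinCoeffs n (σ.erase (removed σ))) (lengthCoeffs (reps σ))

/-- The coefficients of `W_σ(q) / W_{σ∖{s}}(q)`. -/
def quotCoeffs (σ : Finset (Fin 6)) (s : Fin 6) : List ℤ :=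
  let l := poinCoeffs 5 σ
  let m := poinCoeffs 5 (σ.erase s)
  divCoeffs (l.length + 1 - m.length) l m

theorem headD_poinCoeffs : ∀ σ : Finset (Fin 6), σ ≠ Finset.univ →
    (poinCoeffs 5 σ).headD 0 = 1 := by
  decide +kernel

theorem eqCoeffs_mul_quotCoeffs : ∀ σ : Finset (Fin 6), σ ≠ Finset.univ → ∀ s ∈ σ,
    eqCoeffs (poinCoeffs 5 σ) (mulCoeffs (quotCoeffs σ s) (poinCoeffs 5 (σ.erase s))) = true := by
  decide +kernel

variable {W : Type*} [Group W] {Mat : CoxeterMatrix (Fin 6)} (cs : CoxeterSystem Mat W)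

theorem erase_ne_univ (σ : Finset (Fin 6)) (s : Fin 6) : σ.erase s ≠ Finset.univ := fun e =>
  Finset.notMem_erase s σ (e ▸ Finset.mem_univ s)

theorem finite_and_poin_eq (h : IsAffineD5 Mat) {n : ℕ} {σ : Finset (Fin 6)} (hn : σ.card ≤ n)
    (hσ : σ ≠ Finset.univ) :
    (parabolic cs σ : Set W).Finite ∧ poin cs σ = ofCoeffs (poinCoeffs n σ) := by
  have hempty : (parabolic cs (∅ : Finset (Fin 6)) : Set W).Finite ∧
      poin cs (∅ : Finset (Fin 6)) = ofCoeffs [1] := by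
    have hb : (parabolic cs (∅ : Finset (Fin 6)) : Set W) = {1} := by simp [parabolic]
    have hf : (parabolic cs (∅ : Finset (Fin 6)) : Set W).Finite := hb ▸ Set.finite_singleton 1
    refine ⟨hf, ?_⟩
    have hf1 : hf.toFinset = {1} := by ext; simp [hb]
    rw [poin_of_finite cs hf, hf1]
    simp
  induction n generalizing σ with
  | zero =>
    obtain rfl : σ = ∅ := by simpa using hn
    exact hempty
  | succ n ih =>
    rw [poinCoeffs]
    split_ifs with h0
    · subst h0
      exact hempty
    · have hD := isTransversal_reps σ h0 hσ
      have hc : (σ.erase (removed σ)).card ≤ n := by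
        rw [Finset.card_erase_of_mem hD.mem]; omega
      obtain ⟨hf, hp⟩ := ih hc (erase_ne_univ _ _)
      obtain ⟨hf', hp'⟩ := hD.finite_and_poin_eq_mul cs h hf
      exact ⟨hf', by rw [hp', hp, ofCoeffs_mul, ofCoeffs_lengthCoeffs]⟩

theorem card_le_five {σ : Finset (Fin 6)} (hσ : σ ≠ Finset.univ) : σ.card ≤ 5 :=
  Nat.le_of_lt_succ (Finset.card_lt_card (Finset.ssubset_univ_iff.mpr hσ))

theorem poin_div_poin (h : IsAffineD5 Mat) {σ : Finset (Fin 6)} (hσ : σ ≠ Finset.univ)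
    {s : Fin 6} (hs : s ∈ σ) : poin cs σ / poin cs (σ.erase s) = ofCoeffs (quotCoeffs σ s) := by
  have hτ := erase_ne_univ σ s
  rw [(finite_and_poin_eq cs h (card_le_five hσ) hσ).2,
    (finite_and_poin_eq cs h (card_le_five hτ) hτ).2,
    ofCoeffs_eq_of_eqCoeffs (eqCoeffs_mul_quotCoeffs σ hσ s hs), ofCoeffs_mul]
  exact mul_div_cancel_right₀ _ (ofCoeffs_ne_zero (headD_poinCoeffs _ hτ))

theorem finite_parabolic_iff (h : IsAffineD5 Mat) (σ : Finset (Fin 6)) :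
    (parabolic cs σ : Set W).Finite ↔ σ ≠ Finset.univ :=
  ⟨fun hf e => infinite_parabolic_univ cs h (e ▸ hf),
    fun hσ => (finite_and_poin_eq cs h (card_le_five hσ) hσ).1⟩

end PoincarePolynomials

section Certificate

/-- The sets of `k` nodes, encoded as binary numbers. -/
def codes : ℕ → List ℕ
  | 0 => [0]
  | 1 => [1, 2, 4, 8, 16, 32]
  | 2 => [3, 5, 9, 17, 33, 6, 10, 18, 34, 12, 20, 36, 24, 40, 48]
  | 3 => [7, 11, 19, 35, 13, 21, 37, 25, 41, 49, 14, 22, 38, 26, 42, 50, 28, 44, 52, 56]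
  | 4 => [15, 23, 39, 27, 43, 51, 29, 45, 53, 57, 30, 46, 54, 58, 60]
  | 5 => [31, 47, 55, 59, 61, 62]
  | _ => []

/-- The rank of the boundary map from degree `k` to degree `k - 1`. -/
def bdryRank : ℕ → ℕ
  | 1 => 1
  | 2 => 5
  | 3 => 10
  | 4 => 10
  | 5 => 5
  | _ => 0

/-- The nonzero diagonal entries of the boundary map from degree `k` to degree `k - 1` in the adapted
coordinates. -/
def diagCoeffs : ℕ → List (List ℤ)
  | 1 => [[1, 1]]
  | 2 => [[1], [1], [1], [1], [1]]
  | 3 => [[1, 0, 1], [1], [1], [1], [1], [1], [1], [1], [1], [1]]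
  | 4 => [[1, 1, 1, 1, 1], [1], [1], [1], [1], [1], [1], [1], [1], [1]]
  | 5 => [[1, 1], [1, 0, 1, 1, 1, 1, 1, 1, 0, 1], [1, 0, 0, 0, 1], [1, 0, 0, 0, 1], [1]]
  | _ => []

/-- The coordinate functions in degree `k` which diagonalise the boundary maps. -/
def coordRows : ℕ → List (List (ℕ × List ℤ))
  | 0 => [
      [(0, [1])]]
  | 1 => [
      [(1, [1]), (2, [1]), (4, [1]), (8, [1]), (16, [1]), (32, [1])],
      [(4, [1]), (16, [1]), (32, [1])],
      [(4, [-1])],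
      [(4, [1]), (8, [1]), (16, [1]), (32, [1])],
      [(16, [1]), (32, [-1])],
      [(1, [-1]), (2, [1])]]
  | 2 => [
      [(5, [1, 1, 1]), (17, [1, 1]), (33, [1, 1]), (6, [1, 1, 1]), (18, [1, 1]), (34, [1, 1]), (12,
      [-1, -1, -1]), (24, [1, 1, 1]), (40, [1, 1, 1])],
      [(5, [-1, -1, -1]), (6, [-1, -1, -1]), (12, [1, 1, 1]), (20, [1, 1]), (36, [1, 1])],
      [(5, [1, 1, 1]), (9, [1, 1]), (17, [1, 1]), (33, [1, 1]), (6, [1, 1, 1]), (10, [1, 1]), (18,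
      [1, 1]), (34, [1, 1])],
      [(17, [1, 1]), (33, [-1, -1]), (18, [1, 1]), (34, [-1, -1]), (20, [1, 1]), (36, [-1, -1]),
      (24, [1, 1, 1]), (40, [-1, -1, -1]), (48, [-2, -2])],
      [(3, [2, 2]), (5, [1, 1, 1]), (9, [1, 1]), (17, [1, 1]), (33, [1, 1]), (6, [-1, -1, -1]),
      (10, [-1, -1]), (18, [-1, -1]), (34, [-1, -1])],
      [(9, [-1]), (17, [-1]), (33, [-1]), (10, [-1]), (18, [-1]), (34, [-1]), (12, [0, -1]), (20,
      [-1]), (36, [-1])],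
      [(17, [-1]), (33, [-1]), (18, [-1]), (34, [-1]), (24, [0, -1]), (40, [0, -1])],
      [(5, [0, -1]), (6, [0, -1]), (20, [1]), (36, [1])],
      [(17, [-1]), (33, [1]), (18, [-1]), (34, [1]), (20, [-1]), (36, [1]), (24, [0, -1]), (40, [0,
      1]), (48, [2])],
      [(17, [1]), (33, [-1]), (18, [1]), (34, [-1])],
      [(17, [-5]), (33, [5]), (18, [-5]), (34, [5]), (20, [-3]), (36, [3]), (24, [-1, -2]), (40,
      [1, 2]), (48, [4])],
      [(3, [2]), (5, [1]), (9, [1]), (6, [-1]), (10, [-1])],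
      [(3, [-2]), (5, [0, -1]), (9, [-1]), (17, [-1]), (33, [-1]), (6, [0, 1]), (10, [1]), (18,
      [1]), (34, [1])],
      [(3, [1])],
      [(17, [-1]), (33, [1]), (18, [1]), (34, [-1])]]
  | 3 => [
      [(13, [1]), (14, [1]), (28, [1]), (44, [1])],
      [(21, [1, 1, 1]), (37, [1, 1, 1]), (25, [1]), (41, [1]), (22, [1, 1, 1]), (38, [1, 1, 1]),
      (26, [1]), (42, [1]), (28, [0, -1, -1, -1, -1]), (44, [0, -1, -1, -1, -1])],
      [(13, [0, -1, -1, -1, -1]), (21, [1]), (37, [1]), (14, [0, -1, -1, -1, -1]), (22, [1]), (38,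
      [1]), (28, [-1, -1, -2, -1, -1]), (44, [-1, -1, -2, -1, -1])],
      [(25, [1]), (41, [-1]), (26, [1]), (42, [-1]), (28, [1, 0, 1]), (44, [-1, 0, -1]), (56, [2,
      0, 2])],
      [(21, [-1, -1, -1]), (37, [1, 1, 1]), (25, [-1, -1, -1]), (41, [1, 1, 1]), (49, [2, 2]), (22,
      [-1, -1, -1]), (38, [1, 1, 1]), (26, [-1, -1, -1]), (42, [1, 1, 1]), (50, [2, 2])],
      [(21, [2, 2, 2]), (37, [-2, -2, -2]), (25, [4, 2, 3]), (41, [-4, -2, -3]), (49, [-6, -6]),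
      (22, [2, 2, 2]), (38, [-2, -2, -2]), (26, [4, 2, 3]), (42, [-4, -2, -3]), (50, [-6, -6]),
      (28, [2, 0, 3, 0, 1]), (44, [-2, 0, -3, 0, -1]), (52, [-2, -2]), (56, [2, -2, 2, -2])],
      [(7, [0, 0, 2, 0, 2]), (19, [2, 2]), (35, [2, 2]), (13, [0, 0, -1, 0, -1]), (21, [1, 1]),
      (37, [1, 1]), (25, [1, 1, 1]), (41, [1, 1, 1]), (14, [0, 0, 1, 0, 1]), (22, [-1, -1]), (38,
      [-1, -1]), (26, [-1, -1, -1]), (42, [-1, -1, -1])],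
      [(7, [-2, 0, -2]), (13, [1, 0, 1]), (21, [1]), (37, [1]), (14, [-1, 0, -1]), (22, [-1]), (38,
      [-1])],
      [(7, [1, 1, 2, 1, 1]), (11, [1, 1]), (19, [1, 1]), (35, [1, 1])],
      [(19, [2, 2]), (35, [-2, -2]), (21, [1, 1, 1]), (37, [-1, -1, -1]), (25, [1, 1, 1]), (41,
      [-1, -1, -1]), (49, [-2, -2]), (22, [-1, -1, -1]), (38, [1, 1, 1]), (26, [-1, -1, -1]), (42,
      [1, 1, 1]), (50, [2, 2])],
      [(28, [1]), (44, [1])],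
      [(49, [-1]), (50, [-1]), (52, [-1]), (56, [1, -2, 0, -1])],
      [(49, [1]), (50, [1]), (28, [1]), (44, [-1]), (52, [1]), (56, [1, 2, 0, 1])],
      [(21, [0, 1]), (37, [0, -1]), (25, [0, 1]), (41, [0, -1]), (49, [-1]), (22, [0, 1]), (38, [0,
      -1]), (26, [0, 1]), (42, [0, -1]), (50, [-1]), (28, [1]), (44, [-1]), (52, [1]), (56, [-1, 2,
      0, 1])],
      [(11, [-2]), (13, [0, -1, 0, -1]), (25, [0, 1]), (41, [0, 1]), (14, [0, 1, 0, 1]), (26, [0,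
      -1]), (42, [0, -1])],
      [(7, [-2, 2]), (11, [2]), (19, [2]), (35, [2]), (13, [0, 1, 0, 1]), (21, [0, 1]), (37, [0,
      1]), (14, [0, -1, 0, -1]), (22, [0, -1]), (38, [0, -1])],
      [(11, [-2]), (13, [1, -1, 0, -1]), (25, [0, 1]), (41, [0, 1]), (14, [-1, 1, 0, 1]), (26, [0,
      -1]), (42, [0, -1])],
      [(19, [2]), (35, [-2]), (21, [0, 1]), (37, [0, -1]), (25, [0, 1]), (41, [0, -1]), (49, [-2]),
      (22, [0, -1]), (38, [0, 1]), (26, [0, -1]), (42, [0, 1]), (50, [2])],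
      [(19, [-6]), (35, [6]), (21, [-1, -2]), (37, [1, 2]), (25, [-1, -2]), (41, [1, 2]), (49,
      [4]), (22, [1, 2]), (38, [-1, -2]), (26, [1, 2]), (42, [-1, -2]), (50, [-4])],
      [(19, [12]), (35, [-12]), (21, [3, 4]), (37, [-3, -4]), (25, [2, 4]), (41, [-2, -4]), (49,
      [-8]), (22, [-3, -4]), (38, [3, 4]), (26, [-2, -4]), (42, [2, 4]), (50, [8])]]
  | 4 => [
      [(29, [1]), (45, [1]), (30, [1]), (46, [1])],
      [(57, [2]), (58, [2]), (60, [2, 0, 2, 2, 0, 2])],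
      [(29, [1, 1, 1, 1, 1]), (45, [-1, -1, -1, -1, -1]), (57, [0, 2]), (30, [1, 1, 1, 1, 1]), (46,
      [-1, -1, -1, -1, -1]), (58, [0, 2]), (60, [-2, 0, -2, -2, 0, -2])],
      [(29, [1, 1, 1, 1, 1]), (45, [-1, -1, -1, -1, -1]), (53, [2]), (57, [0, 0, 2]), (30, [1, 1,
      1, 1, 1]), (46, [-1, -1, -1, -1, -1]), (54, [2]), (58, [0, 0, 2]), (60, [-4, -2, -4, -6, -2,
      -4, -2])],
      [(15, [-2, 0, -4, -2, -2, -4, 0, -2]), (27, [2]), (43, [2])],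
      [(15, [4, 0, 4, 4, 0, 4]), (23, [4]), (39, [4])],
      [(15, [-4, -2, -6, -6, -4, -6, -2, -2]), (27, [2]), (43, [2]), (29, [-1, -1, -1, -1, -1]),
      (45, [-1, -1, -1, -1, -1]), (30, [1, 1, 1, 1, 1]), (46, [1, 1, 1, 1, 1])],
      [(23, [2, 0, 2]), (39, [-2, 0, -2]), (27, [2]), (43, [-2]), (53, [2]), (57, [2, 0, 2]), (54,
      [-2]), (58, [-2, 0, -2])],
      [(23, [-4, 0, -6, 0, -2]), (39, [4, 0, 6, 0, 2]), (27, [-4, 0, -2]), (43, [4, 0, 2]), (51,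
      [4, 4]), (53, [-2, 2]), (57, [-2, 2, -2, 2]), (54, [2, -2]), (58, [2, -2, 2, -2])],
      [(23, [6, -2, 10, -2, 4]), (39, [-6, 2, -10, 2, -4]), (27, [8, 0, 4]), (43, [-8, 0, -4]),
      (51, [-8, -8]), (29, [1, 1, 2, 2, 2, 1, 1]), (45, [-1, -1, -2, -2, -2, -1, -1]), (53, [2,
      -6]), (57, [4, -4, 4, -4]), (30, [-1, -1, -2, -2, -2, -1, -1]), (46, [1, 1, 2, 2, 2, 1, 1]),
      (54, [-2, 6]), (58, [-4, 4, -4, 4])],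
      [(23, [1]), (39, [-1])],
      [(27, [-2]), (43, [2]), (29, [1, -2, 0, -2, 0, -1]), (45, [-1, 2, 0, 2, 0, 1]), (57, [-2, 0,
      -2]), (30, [-1, 2, 0, 2, 0, 1]), (46, [1, -2, 0, -2, 0, -1]), (58, [2, 0, 2])],
      [(29, [0, -1, -1, -1]), (45, [0, 1, 1, 1]), (57, [-2]), (30, [0, -1, -1, -1]), (46, [0, 1, 1,
      1]), (58, [-2]), (60, [0, 0, 0, 0, 2])],
      [(15, [0, 0, 0, 0, 2]), (23, [-2]), (39, [-2]), (29, [0, 1, 1, 1]), (45, [0, 1, 1, 1]), (30,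
      [0, -1, -1, -1]), (46, [0, -1, -1, -1])],
      [(51, [2]), (57, [-1, 2, 0, 1]), (58, [1, -2, 0, -1])]]
  | 5 => [
      [(31, [-1, 0, -2, -1, -3, -1, -4, -1, -3, -1, -2, 0, -1]), (47, [1, 0, 2, 1, 3, 1, 4, 1, 3,
      1, 2, 0, 1]), (55, [2])],
      [(31, [-4]), (47, [4]), (61, [4]), (62, [-4])],
      [(61, [2]), (62, [2])],
      [(31, [2]), (47, [2])],
      [(55, [2, 2, 4, 2, 2]), (59, [4]), (61, [1, -1, 0, -2, -3, -6, -6, -9, -10, -9, -10, -8, -7,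
      -4, -4, -1, -1]), (62, [-1, 1, 0, 2, 3, 6, 6, 9, 10, 9, 10, 8, 7, 4, 4, 1, 1])],
      [(61, [1]), (62, [-1])]]
  | _ => []

/-- 16 times the basis dual to `coordRows`. -/
def basisCols : ℕ → List (List (ℕ × List ℤ))
  | 0 => [
      [(0, [16])]]
  | 1 => [
      [(1, [8]), (2, [8])],
      [(8, [-16]), (16, [8]), (32, [8])],
      [(4, [-16]), (16, [8]), (32, [8])],
      [(1, [-8]), (2, [-8]), (8, [16])],
      [(16, [8]), (32, [-8])],
      [(1, [-8]), (2, [8])]]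
  | 2 => [
      [(9, [0, 8]), (17, [0, -4]), (33, [0, -4]), (10, [0, 8]), (18, [0, -4]), (34, [0, -4]), (24,
      [8]), (40, [8])],
      [(5, [0, 8, 8]), (9, [0, 0, -8, -16, -16, -8]), (17, [0, -4, 0, 4, 8, 4]), (33, [0, -4, 0, 4,
      8, 4]), (6, [0, 8, 8]), (10, [0, 0, -8, -16, -16, -8]), (18, [0, -4, 0, 4, 8, 4]), (34, [0,
      -4, 0, 4, 8, 4]), (12, [16]), (20, [0, 0, 8, 8]), (36, [0, 0, 8, 8]), (24, [8, 0, -8, -16,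
      -8]), (40, [8, 0, -8, -16, -8])],
      [(5, [8, 8, 8]), (9, [0, -16, -16, -24, -16, -8]), (17, [0, 0, 4, 8, 8, 4]), (33, [0, 0, 4,
      8, 8, 4]), (6, [8, 8, 8]), (10, [0, -16, -16, -24, -16, -8]), (18, [0, 0, 4, 8, 8, 4]), (34,
      [0, 0, 4, 8, 8, 4]), (12, [16]), (20, [0, 8, 8, 8]), (36, [0, 8, 8, 8]), (24, [0, -8, -16,
      -16, -8]), (40, [0, -8, -16, -16, -8])],
      [(20, [-8]), (36, [8]), (24, [8]), (40, [-8]), (48, [-8, 8])],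
      [(5, [8]), (9, [-8]), (17, [4, -4]), (33, [4, -4]), (6, [-8]), (10, [8]), (18, [-4, 4]), (34,
      [-4, 4])],
      [(5, [8, 16, 16, 8]), (9, [-8, -16, -32, -40, -40, -24, -8]), (17, [0, 0, 4, 12, 16, 12, 4]),
      (33, [0, 0, 4, 12, 16, 12, 4]), (6, [8, 16, 16, 8]), (10, [-8, -16, -32, -40, -40, -24, -8]),
      (18, [0, 0, 4, 12, 16, 12, 4]), (34, [0, 0, 4, 12, 16, 12, 4]), (12, [16, 16]), (20, [0, 8,
      16, 16, 8]), (36, [0, 8, 16, 16, 8]), (24, [0, -8, -24, -32, -24, -8]), (40, [0, -8, -24,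
      -32, -24, -8])],
      [(9, [8, 8, 8]), (17, [-4, -4, -4]), (33, [-4, -4, -4]), (10, [8, 8, 8]), (18, [-4, -4, -4]),
      (34, [-4, -4, -4]), (24, [8, 8]), (40, [8, 8])],
      [(5, [8, 8]), (9, [-8, -16, -24, -16, -8]), (17, [0, 4, 8, 8, 4]), (33, [0, 4, 8, 8, 4]), (6,
      [8, 8]), (10, [-8, -16, -24, -16, -8]), (18, [0, 4, 8, 8, 4]), (34, [0, 4, 8, 8, 4]), (20,
      [8, 8, 8]), (36, [8, 8, 8]), (24, [-8, -16, -16, -8]), (40, [-8, -16, -16, -8])],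
      [(20, [8, -8]), (36, [-8, 8]), (24, [8, 8]), (40, [-8, -8]), (48, [16, 0, 8])],
      [(17, [4]), (33, [-4]), (18, [4]), (34, [-4]), (20, [-24]), (36, [24]), (48, [-16])],
      [(20, [-8]), (36, [8]), (48, [-8])],
      [(9, [8]), (17, [-4]), (33, [-4]), (10, [-8]), (18, [4]), (34, [4])],
      [(5, [8, 8]), (9, [-8, -8]), (17, [0, 0, -4]), (33, [0, 0, -4]), (6, [-8, -8]), (10, [8, 8]),
      (18, [0, 0, 4]), (34, [0, 0, 4])],
      [(3, [16]), (9, [-16]), (10, [16])],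
      [(17, [-4]), (33, [4]), (18, [4]), (34, [-4])]]
  | 3 => [
      [(13, [8]), (21, [0, 4, 4, 4, 4]), (37, [0, 4, 4, 4, 4]), (25, [0, -4, -8, -12, -12, -8,
      -4]), (41, [0, -4, -8, -12, -12, -8, -4]), (14, [8]), (22, [0, 4, 4, 4, 4]), (38, [0, 4, 4,
      4, 4]), (26, [0, -4, -8, -12, -12, -8, -4]), (42, [0, -4, -8, -12, -12, -8, -4])],
      [(25, [4]), (41, [4]), (26, [4]), (42, [4])],
      [(21, [4]), (37, [4]), (25, [-4, -4, -4]), (41, [-4, -4, -4]), (22, [4]), (38, [4]), (26,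
      [-4, -4, -4]), (42, [-4, -4, -4])],
      [(21, [-8, -4, -2, -2]), (37, [8, 4, 2, 2]), (25, [4]), (41, [-4]), (49, [-4, -4, -6, -2,
      -2]), (22, [-8, -4, -2, -2]), (38, [8, 4, 2, 2]), (26, [4]), (42, [-4]), (50, [-4, -4, -6,
      -2, -2]), (28, [-8, 0, -4]), (44, [8, 0, 4]), (52, [16, -8, 16, -12, 4, -4]), (56, [8, 0,
      4])],
      [(21, [0, 4]), (37, [0, -4]), (49, [4, 0, 4]), (22, [0, 4]), (38, [0, -4]), (50, [4, 0, 4]),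
      (28, [8]), (44, [-8]), (52, [-16, 16, -8, 8]), (56, [-8])],
      [(21, [2, 2]), (37, [-2, -2]), (49, [2, 2, 2]), (22, [2, 2]), (38, [-2, -2]), (50, [2, 2,
      2]), (28, [4]), (44, [-4]), (52, [-8, 4, -4, 4]), (56, [-4])],
      [(11, [0, 8]), (19, [0, -4]), (35, [0, -4]), (25, [4]), (41, [4]), (26, [-4]), (42, [-4])],
      [(7, [0, 4, 4]), (11, [0, -8, -8]), (19, [0, 2, 2, -4, -2, -2]), (35, [0, 2, 2, -4, -2, -2]),
      (21, [4, 2, 2, 2, 2]), (37, [4, 2, 2, 2, 2]), (25, [-4, -4]), (41, [-4, -4]), (22, [-4, -2,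
      -2, -2, -2]), (38, [-4, -2, -2, -2, -2]), (26, [4, 4]), (42, [4, 4])],
      [(7, [8]), (11, [0, -16]), (19, [4, 0, 0, -4]), (35, [4, 0, 0, -4]), (21, [4, 0, 4]), (37,
      [4, 0, 4]), (25, [-8]), (41, [-8]), (22, [-4, 0, -4]), (38, [-4, 0, -4]), (26, [8]), (42,
      [8])],
      [(19, [-4]), (35, [4]), (25, [4]), (41, [-4]), (49, [-4, 4]), (26, [-4]), (42, [4]), (50, [4,
      -4])],
      [(13, [-8]), (21, [4, 0, 4]), (37, [4, 0, 4]), (25, [-4, 0, -4]), (41, [-4, 0, -4]), (14,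
      [-8]), (22, [4, 0, 4]), (38, [4, 0, 4]), (26, [-4, 0, -4]), (42, [-4, 0, -4]), (28, [8]),
      (44, [8])],
      [(21, [0, -8]), (37, [0, 8]), (25, [-4, 0, -4]), (41, [4, 0, 4]), (49, [-4, -8, -8, -4]),
      (22, [0, -8]), (38, [0, 8]), (26, [-4, 0, -4]), (42, [4, 0, 4]), (50, [-4, -8, -8, -4]), (28,
      [0, -8]), (44, [0, 8]), (52, [0, 8, 0, 0, -8]), (56, [8, 8])],
      [(21, [8, 4, 4]), (37, [-8, -4, -4]), (25, [-4, 0, -4]), (41, [4, 0, 4]), (49, [4, 4, 4]),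
      (22, [8, 4, 4]), (38, [-8, -4, -4]), (26, [-4, 0, -4]), (42, [4, 0, 4]), (50, [4, 4, 4]),
      (28, [8]), (44, [-8]), (52, [-8, -8, -8])],
      [(21, [-4, -4]), (37, [4, 4]), (49, [-4, -4, -4]), (22, [-4, -4]), (38, [4, 4]), (50, [-4,
      -4, -4]), (52, [8, 8, 8])],
      [(11, [-8, -8, -8]), (19, [4, 4, 4]), (35, [4, 4, 4]), (13, [-8]), (21, [4, 0, 4]), (37, [4,
      0, 4]), (25, [-8, -4, -4]), (41, [-8, -4, -4]), (14, [8]), (22, [-4, 0, -4]), (38, [-4, 0,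
      -4]), (26, [8, 4, 4]), (42, [8, 4, 4])],
      [(7, [-4, -4]), (19, [2, 2, 4, 2, 2]), (35, [2, 2, 4, 2, 2]), (21, [-2, -2, -2, -2]), (37,
      [-2, -2, -2, -2]), (22, [2, 2, 2, 2]), (38, [2, 2, 2, 2])],
      [(13, [8]), (21, [-4, 0, -4]), (37, [-4, 0, -4]), (25, [4, 0, 4]), (41, [4, 0, 4]), (14,
      [-8]), (22, [4, 0, 4]), (38, [4, 0, 4]), (26, [-4, 0, -4]), (42, [-4, 0, -4])],
      [(19, [-4, 4]), (35, [4, -4]), (25, [-4, -4]), (41, [4, 4]), (49, [-8, 0, -4]), (26, [4, 4]),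
      (42, [-4, -4]), (50, [8, 0, 4])],
      [(19, [-4]), (35, [4]), (21, [8]), (37, [-8]), (25, [-8]), (41, [8]), (49, [-4]), (22, [-8]),
      (38, [8]), (26, [8]), (42, [-8]), (50, [4])],
      [(21, [4]), (37, [-4]), (25, [-4]), (41, [4]), (22, [-4]), (38, [4]), (26, [4]), (42, [-4])]]
  | 4 => [
      [(29, [4]), (45, [4]), (30, [4]), (46, [4])],
      [(29, [4, 0, 4, 4]), (45, [-4, 0, -4, -4]), (53, [4, 8, 4, 12, 8, 12, 8, 4, 4]), (57, [0, -4,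
      -4, -8, -4, -4, -4]), (30, [4, 0, 4, 4]), (46, [-4, 0, -4, -4]), (54, [4, 8, 4, 12, 8, 12, 8,
      4, 4]), (58, [0, -4, -4, -8, -4, -4, -4]), (60, [8, 8])],
      [(29, [4, 0, 4, 4, 4, 4]), (45, [-4, 0, -4, -4, -4, -4]), (53, [-4, 4, 4, 12, 12, 16, 16, 12,
      12, 4, 4]), (57, [0, -4, -4, -8, -8, -8, -8, -4, -4]), (30, [4, 0, 4, 4, 4, 4]), (46, [-4, 0,
      -4, -4, -4, -4]), (54, [-4, 4, 4, 12, 12, 16, 16, 12, 12, 4, 4]), (58, [0, -4, -4, -8, -8,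
      -8, -8, -4, -4]), (60, [0, 8, 8, 8])],
      [(53, [4]), (54, [4])],
      [(15, [0, -8, -8, -8]), (23, [0, 4, 4, 8, 8, 8, 8, 4, 4]), (39, [0, 4, 4, 8, 8, 8, 8, 4, 4]),
      (27, [4, -4, -4, -12, -12, -16, -16, -12, -12, -4, -4]), (43, [4, -4, -4, -12, -12, -16, -16,
      -12, -12, -4, -4]), (29, [4, 0, 4, 4, 4, 4]), (45, [4, 0, 4, 4, 4, 4]), (30, [-4, 0, -4, -4,
      -4, -4]), (46, [-4, 0, -4, -4, -4, -4])],
      [(15, [4, 4, 4, 4, 4]), (23, [0, -2, -4, -6, -6, -6, -6, -4, -2, -2]), (39, [0, -2, -4, -6,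
      -6, -6, -6, -4, -2, -2]), (27, [2, 2, 6, 8, 10, 12, 12, 10, 8, 6, 2, 2]), (43, [2, 2, 6, 8,
      10, 12, 12, 10, 8, 6, 2, 2]), (29, [-2, -2, -2, -4, -2, -2, -2]), (45, [-2, -2, -2, -4, -2,
      -2, -2]), (30, [2, 2, 2, 4, 2, 2, 2]), (46, [2, 2, 2, 4, 2, 2, 2])],
      [(15, [0, 8, 8, 8]), (23, [0, -4, -4, -8, -8, -8, -8, -4, -4]), (39, [0, -4, -4, -8, -8, -8,
      -8, -4, -4]), (27, [0, 4, 4, 12, 12, 16, 16, 12, 12, 4, 4]), (43, [0, 4, 4, 12, 12, 16, 16,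
      12, 12, 4, 4]), (29, [-4, 0, -4, -4, -4, -4]), (45, [-4, 0, -4, -4, -4, -4]), (30, [4, 0, 4,
      4, 4, 4]), (46, [4, 0, 4, 4, 4, 4])],
      [(27, [-1, 0, -5, 3, 4, 8, 8, 7, 5, 2, 1]), (43, [1, 0, 5, -3, -4, -8, -8, -7, -5, -2, -1]),
      (51, [3, -8, 2, -4, 6, 9, 11, 12, 8, 6, 2, 1]), (29, [2, 2]), (45, [-2, -2]), (53, [2, 2, 4,
      4, 4, 2, 2]), (57, [3, -2, -2, -5, -6, -5, -4, -2, -1]), (30, [-2, -2]), (46, [2, 2]), (54,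
      [-2, -2, -4, -4, -4, -2, -2]), (58, [-3, 2, 2, 5, 6, 5, 4, 2, 1])],
      [(27, [0, -6, -2, 2, 6, 10, 6, 8, 2, 2]), (43, [0, 6, 2, -2, -6, -10, -6, -8, -2, -2]), (51,
      [4, -10, 2, -8, 14, 4, 18, 6, 10, 2, 2]), (29, [4]), (45, [-4]), (53, [-4, 8, 0, 8, 0, 4]),
      (57, [4, -2, -2, -8, -4, -6, -2, -2]), (30, [-4]), (46, [4]), (54, [4, -8, 0, -8, 0, -4]),
      (58, [-4, 2, 2, 8, 4, 6, 2, 2])],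
      [(27, [1, -3, 0, 1, 3, 5, 3, 4, 1, 1]), (43, [-1, 3, 0, -1, -3, -5, -3, -4, -1, -1]), (51,
      [1, -3, 1, -3, 7, 2, 9, 3, 5, 1, 1]), (29, [2]), (45, [-2]), (53, [-2, 4, 0, 4, 0, 2]), (57,
      [1, -1, -1, -4, -2, -3, -1, -1]), (30, [-2]), (46, [2]), (54, [2, -4, 0, -4, 0, -2]), (58,
      [-1, 1, 1, 4, 2, 3, 1, 1])],
      [(23, [8]), (39, [-8]), (27, [-4, -4, -12, -8, -12, -4, -4]), (43, [4, 4, 12, 8, 12, 4, 4]),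
      (51, [4, -4, 0, -16, -8, -16, -4, -4]), (53, [-8, 0, -8]), (57, [4, 4, 8, 4, 4]), (54, [8, 0,
      8]), (58, [-4, -4, -8, -4, -4])],
      [(27, [-1, 0, 1, 3, 6, 8, 8, 7, 5, 2, 1]), (43, [1, 0, -1, -3, -6, -8, -8, -7, -5, -2, -1]),
      (51, [-1, 0, 0, 4, 6, 11, 11, 12, 8, 6, 2, 1]), (29, [2, 2]), (45, [-2, -2]), (53, [2, 2, 4,
      4, 4, 2, 2]), (57, [-1, -2, -4, -5, -6, -5, -4, -2, -1]), (30, [-2, -2]), (46, [2, 2]), (54,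
      [-2, -2, -4, -4, -4, -2, -2]), (58, [1, 2, 4, 5, 6, 5, 4, 2, 1])],
      [(29, [4, 4, 4, 8, 4, 4, 4]), (45, [-4, -4, -4, -8, -4, -4, -4]), (53, [4, 4, 12, 16, 20, 24,
      24, 20, 16, 12, 4, 4]), (57, [-4, -4, -8, -12, -12, -12, -12, -8, -4, -4]), (30, [4, 4, 4, 8,
      4, 4, 4]), (46, [-4, -4, -4, -8, -4, -4, -4]), (54, [4, 4, 12, 16, 20, 24, 24, 20, 16, 12, 4,
      4]), (58, [-4, -4, -8, -12, -12, -12, -12, -8, -4, -4]), (60, [8, 8, 8, 8, 8])],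
      [(15, [8, 8, 8, 8, 8]), (23, [-4, -4, -8, -12, -12, -12, -12, -8, -4, -4]), (39, [-4, -4, -8,
      -12, -12, -12, -12, -8, -4, -4]), (27, [4, 4, 12, 16, 20, 24, 24, 20, 16, 12, 4, 4]), (43,
      [4, 4, 12, 16, 20, 24, 24, 20, 16, 12, 4, 4]), (29, [-4, -4, -4, -8, -4, -4, -4]), (45, [-4,
      -4, -4, -8, -4, -4, -4]), (30, [4, 4, 4, 8, 4, 4, 4]), (46, [4, 4, 4, 8, 4, 4, 4])],
      [(27, [4, 4, 4, 4]), (43, [-4, -4, -4, -4]), (51, [4, 4, 8, 4, 4]), (57, [-4, -4]), (58, [4,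
      4])]]
  | 5 => [
      [(55, [8]), (59, [-4, -4, -8, -4, -4])],
      [(31, [-2]), (47, [2]), (55, [-2, 0, -4, -2, -6, -2, -8, -2, -6, -2, -4, 0, -2]), (59, [1, 1,
      4, 4, 9, 8, 14, 11, 16, 11, 14, 8, 9, 4, 4, 1, 1])],
      [(61, [4]), (62, [4])],
      [(31, [4]), (47, [4])],
      [(59, [4])],
      [(31, [8]), (47, [-8]), (55, [8, 0, 16, 8, 24, 8, 32, 8, 24, 8, 16, 0, 8]), (59, [-8, 0, -16,
      -8, -24, -8, -32, -8, -24, -8, -16, 0, -8]), (61, [8]), (62, [-8])]]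
  | _ => []

/-- The binary number encoding a set of nodes. -/
def code (σ : Finset (Fin 6)) : ℕ := (nodes σ).foldr (fun s c => 2 ^ s.val + c) 0

/-- The entry with index `c` of a sparse vector of coefficient lists. -/
def sparseEntry (v : List (ℕ × List ℤ)) (c : ℕ) : List ℤ := (v.lookup c).getD []

/-- The entry in row `i` at the column encoded by `c` of the coordinate matrix in degree `k`. -/
def coordCoeffs (k i c : ℕ) : List ℤ := sparseEntry ((coordRows k).getD i []) c

/-- The entry in column `i` at the row encoded by `c` of the basis matrix in degree `k`. -/
def basisCoeffs (k i c : ℕ) : List ℤ := sparseEntry ((basisCols k).getD i []) c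

/-- The coefficient list of `∑ c ∈ l, f c * g c`. -/
def sumCoeffs {α : Type*} (l : List α) (f g : α → List ℤ) : List ℤ :=
  l.foldr (fun c r => addCoeffs (mulCoeffs (f c) (g c)) r) []

theorem map_code_powersetCard : ∀ k < 6,
    (Finset.powersetCard k (Finset.univ : Finset (Fin 6))).val.map code = (codes k : Multiset ℕ) := by
  decide +kernel

theorem coordCoeffs_mul_basisCoeffs : ∀ k < 6, ∀ i < (codes k).length, ∀ j < (codes k).length,
    eqCoeffs (sumCoeffs (codes k) (coordCoeffs k i) (basisCoeffs k j))
      (if i = j then [16] else []) = true := by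
  decide +kernel

theorem coordCoeffs_mul_bdryCoeffs : ∀ k < 5, ∀ σ ∈ Finset.powersetCard (k + 1) Finset.univ,
    ∀ i < (codes k).length,
    eqCoeffs (sumCoeffs (nodes σ) (fun s => coordCoeffs k i (code (σ.erase s)))
        (fun s => smulCoeffs ((-1) ^ (σ.filter (· < s)).card) (quotCoeffs σ s)))
      (if i < bdryRank k then [] else mulCoeffs ((diagCoeffs (k + 1)).getD (i - bdryRank k) [])
        (coordCoeffs (k + 1) (i - bdryRank k) (code σ))) = true := by
  decide +kernel

end Certificate

section AdaptedCoordinates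

/-- The Laurent polynomial with the given list of coefficients. -/
noncomputable def toR (l : List ℤ) : R := toLaurent (ofCoeffs l)

@[simp] theorem toR_nil : toR [] = 0 := by simp [toR]

theorem toR_eq_of_eqCoeffs {l m : List ℤ} (h : eqCoeffs l m = true) : toR l = toR m :=
  congrArg toLaurent (ofCoeffs_eq_of_eqCoeffs h)

theorem toR_mul (l m : List ℤ) : toR (mulCoeffs l m) = toR l * toR m := by
  simp [toR]

theorem toR_sumCoeffs {α : Type*} (l : List α) (f g : α → List ℤ) :
    toR (sumCoeffs l f g) = (l.map fun c => toR (f c) * toR (g c)).sum := by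
  induction l with
  | nil => simp [sumCoeffs]
  | cons c l ih =>
    rw [List.map_cons, List.sum_cons, ← ih]
    simp [sumCoeffs, toR]

/-- The diagonal entries of the boundary map from degree `k` in the adapted coordinates. -/
noncomputable def diag (k j : ℕ) : R := toR ((diagCoeffs k).getD j [])

theorem codes_of_le {k : ℕ} (hk : 6 ≤ k) : codes k = [] := by
  obtain ⟨k, rfl⟩ := Nat.exists_eq_add_of_le' hk
  rfl

theorem coordRows_of_le {k : ℕ} (hk : 6 ≤ k) : coordRows k = [] := by
  obtain ⟨k, rfl⟩ := Nat.exists_eq_add_of_le' hk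
  rfl

theorem diagCoeffs_of_le {k : ℕ} (hk : 6 ≤ k) : diagCoeffs k = [] := by
  obtain ⟨k, rfl⟩ := Nat.exists_eq_add_of_le' hk
  rfl

theorem bdryRank_of_le {k : ℕ} (hk : 6 ≤ k) : bdryRank k = 0 := by
  obtain ⟨k, rfl⟩ := Nat.exists_eq_add_of_le' hk
  rfl

theorem length_coordRows (k : ℕ) : (coordRows k).length = (codes k).length := by
  rcases lt_or_ge k 6 with hk | hk
  · revert k
    decide
  · rw [codes_of_le hk, coordRows_of_le hk]
    rfl

theorem length_diagCoeffs (k : ℕ) : (diagCoeffs k).length = bdryRank k := by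
  rcases lt_or_ge k 6 with hk | hk
  · revert k
    decide
  · rw [diagCoeffs_of_le hk, bdryRank_of_le hk]
    rfl

theorem bdryRank_le (k : ℕ) : bdryRank k ≤ (codes k).length := by
  rcases lt_or_ge k 6 with hk | hk
  · revert k
    decide
  · simp [bdryRank_of_le hk]

theorem bdryRank_add_le (k : ℕ) : bdryRank k + bdryRank (k + 1) ≤ (codes k).length := by
  rcases lt_or_ge k 6 with hk | hk
  · revert k
    decide
  · simp [bdryRank_of_le hk, bdryRank_of_le (hk.trans (Nat.le_succ k))]

theorem diag_of_le {k j : ℕ} (hj : bdryRank k ≤ j) : diag k j = 0 := by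
  rw [diag, List.getD_eq_default _ _ (by rwa [length_diagCoeffs]), toR_nil]

theorem diag_ne_zero {k j : ℕ} (hj : j < bdryRank k) : diag k j ≠ 0 := by
  have hd : ∀ k < 6, ∀ j < bdryRank k, ((diagCoeffs k).getD j []).headD 0 = 1 := by decide
  have hk : k < 6 := by
    by_contra! hk
    simp [bdryRank_of_le hk] at hj
  rw [diag, toR, Ne, map_eq_zero_iff _ toLaurent_injective]
  exact ofCoeffs_ne_zero (hd k hk j hj)

variable {W : Type*} [Group W] {Mat : CoxeterMatrix (Fin 6)} (cs : CoxeterSystem Mat W)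

theorem mem_powersetCard_iff (h : IsAffineD5 Mat) {k : ℕ} (hk : k < 6) (σ : Finset (Fin 6)) :
    σ ∈ Finset.powersetCard k Finset.univ ↔
      σ.card = k ∧ (parabolic cs σ : Set W).Finite := by
  rw [finite_parabolic_iff cs h]
  simp only [Finset.mem_powersetCard, Finset.subset_univ, true_and, iff_self_and]
  rintro rfl rfl
  simp at hk

theorem isEmpty_KW (h : IsAffineD5 Mat) {k : ℕ} (hk : 6 ≤ k) : IsEmpty (KW cs k) := by
  refine ⟨fun ⟨σ, hc, hf⟩ => ?_⟩
  have := card_le_five ((finite_parabolic_iff cs h σ).mp hf)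
  omega

theorem sum_KW (h : IsAffineD5 Mat) {k : ℕ} (hk : k < 6) {A : Type*} [AddCommMonoid A]
    (f : ℕ → A) : ∑ σ : KW cs k, f (code σ.1) = ((codes k).map f).sum := by
  have e := congrArg (fun m => (m.map f).sum) (map_code_powersetCard k hk)
  rw [← Finset.sum_subtype _ (mem_powersetCard_iff cs h hk) (fun σ => f (code σ)), Finset.sum]
  simpa [Function.comp_def] using e

theorem card_KW (h : IsAffineD5 Mat) (k : ℕ) : Fintype.card (KW cs k) = (codes k).length := by
  rcases lt_or_ge k 6 with hk | hk
  · simpa using sum_KW cs h hk fun _ => (1 : ℕ)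
  · have := isEmpty_KW cs h hk
    simp [codes_of_le hk]

/-- Coordinates on the `k`-chains which diagonalise the boundary maps. -/
noncomputable def coord (k : ℕ) : (KW cs k → R) →ₗ[R] (ℕ → R) :=
  LinearMap.pi fun i => ∑ σ, toR (coordCoeffs k i (code σ.1)) • LinearMap.proj σ

theorem coord_apply (k : ℕ) (x : KW cs k → R) (i : ℕ) :
    coord cs k x i = ∑ σ, toR (coordCoeffs k i (code σ.1)) * x σ := by
  simp [coord]

theorem coord_of_le {k i : ℕ} (hi : (codes k).length ≤ i) (x : KW cs k → R) :
    coord cs k x i = 0 := by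
  have h0 : ∀ c, coordCoeffs k i c = [] := fun c => by
    rw [coordCoeffs, List.getD_eq_default _ _ (by rwa [length_coordRows])]
    rfl
  simp [coord_apply, h0]

theorem exists_sixteen_mul_eq_one : ∃ u : R, 16 * u = 1 := by
  refine ⟨algebraMap ℚ R 16⁻¹, ?_⟩
  rw [← map_ofNat (algebraMap ℚ R) 16, ← map_mul]
  norm_num

theorem coord_invertible (h : IsAffineD5 Mat) (k : ℕ) :
    ∃ (P : Matrix (Fin (codes k).length) (KW cs k) R) (Q : Matrix (KW cs k) (Fin (codes k).length) R),
      (∀ x i, P.mulVec x i = coord cs k x i) ∧ P * Q = 1 ∧ Q * P = 1 := by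
  obtain ⟨u, hu⟩ := exists_sixteen_mul_eq_one
  let P : Matrix (Fin (codes k).length) (KW cs k) R :=
    Matrix.of fun i σ => toR (coordCoeffs k i (code σ.1))
  let Q : Matrix (KW cs k) (Fin (codes k).length) R :=
    Matrix.of fun σ j => toR (basisCoeffs k j (code σ.1)) * u
  have hPQ : P * Q = 1 := by
    refine Matrix.ext fun i j => ?_
    rcases lt_or_ge k 6 with hk | hk
    · have e := toR_eq_of_eqCoeffs (coordCoeffs_mul_basisCoeffs k hk i i.2 j j.2)
      rw [toR_sumCoeffs, ← sum_KW cs h hk] at e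
      simp only [Matrix.mul_apply, P, Q, Matrix.of_apply, ← mul_assoc]
      rw [← Finset.sum_mul, e, Matrix.one_apply]
      rcases eq_or_ne i j with rfl | hij
      · have h16 : toR [16] = 16 := by
          simpa [toR] using map_ofNat (toLaurent (R := ℚ)) 16
        rw [if_pos rfl, if_pos rfl, h16, hu]
      · simp [hij, Fin.val_ne_of_ne hij]
    · have := isEmpty_KW cs h hk
      exact (Fin.cast (by simp [codes_of_le hk]) i : Fin 0).elim0
  refine ⟨P, Q, fun x i => ?_, hPQ, ?_⟩
  · simp [coord_apply, P, Matrix.mulVec, dotProduct]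
  · exact (Matrix.mul_eq_one_comm_of_card_eq _ _ _ (by simp [card_KW cs h])).mp hPQ

theorem coord_injective (h : IsAffineD5 Mat) (k : ℕ) : Function.Injective (coord cs k) := by
  obtain ⟨P, Q, hP, -, hQP⟩ := coord_invertible cs h k
  intro x y hxy
  have hxy' : P.mulVec x = P.mulVec y := by
    funext i
    rw [hP, hP, hxy]
  have := congrArg Q.mulVec hxy'
  simpa [Matrix.mulVec_mulVec, hQP] using this

theorem exists_coord_eq (h : IsAffineD5 Mat) (k : ℕ) (y : ℕ → R) :
    ∃ x, ∀ i < (codes k).length, coord cs k x i = y i := by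
  obtain ⟨P, Q, hP, hPQ, -⟩ := coord_invertible cs h k
  refine ⟨Q.mulVec fun i => y i, fun i hi => ?_⟩
  rw [← hP _ ⟨i, hi⟩, Matrix.mulVec_mulVec, hPQ, Matrix.one_mulVec]

theorem sum_mul_bcoeff (h : IsAffineD5 Mat) {k : ℕ} (σ : KW cs (k + 1)) (f : Finset (Fin 6) → R) :
    ∑ τ : KW cs k, f τ.1 * bcoeff cs σ.1 τ.1 = ∑ s ∈ σ.1, f (σ.1.erase s) *
      toR (smulCoeffs ((-1) ^ (σ.1.filter (· < s)).card) (quotCoeffs σ.1 s)) := by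
  simp only [bcoeff, Finset.mul_sum]
  rw [Finset.sum_comm]
  refine Finset.sum_congr rfl fun s hs => ?_
  have hσ := (finite_parabolic_iff cs h _).mp σ.2.2
  have hτ := (finite_parabolic_iff cs h _).mpr (erase_ne_univ σ.1 s)
  have hc : (σ.1.erase s).card = k := by
    rw [Finset.card_erase_of_mem hs, σ.2.1, Nat.add_sub_cancel]
  rw [Finset.sum_eq_single (⟨σ.1.erase s, hc, hτ⟩ : KW cs k)]
  · rw [if_pos rfl, poin_div_poin cs h hσ hs]
    simp [toR]
  · intro τ _ hne
    rw [if_neg fun e => hne (Subtype.ext e), mul_zero]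
  · simp

theorem coord_bdry (h : IsAffineD5 Mat) (k : ℕ) (x : KW cs (k + 1) → R) (i : ℕ) :
    coord cs k (bdry cs k x) i = if i < bdryRank k then 0 else
      diag (k + 1) (i - bdryRank k) * coord cs (k + 1) x (i - bdryRank k) := by
  rcases lt_or_ge k 5 with hk | hk
  · rcases lt_or_ge i (codes k).length with hi | hi
    · have hcol : ∀ σ : KW cs (k + 1),
          ∑ τ : KW cs k, toR (coordCoeffs k i (code τ.1)) * bcoeff cs σ.1 τ.1 =
          if i < bdryRank k then 0 else diag (k + 1) (i - bdryRank k) *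
            toR (coordCoeffs (k + 1) (i - bdryRank k) (code σ.1)) := by
        intro σ
        rw [sum_mul_bcoeff cs h σ fun τ => toR (coordCoeffs k i (code τ))]
        have e := toR_eq_of_eqCoeffs (coordCoeffs_mul_bdryCoeffs k hk σ.1
          ((mem_powersetCard_iff cs h (by omega) σ.1).mpr σ.2) i hi)
        have hn : (nodes σ.1).Nodup := (List.nodup_finRange 6).filter _
        have hf : (nodes σ.1).toFinset = σ.1 := by ext; simp [nodes]
        rw [toR_sumCoeffs, ← List.sum_toFinset _ hn, hf] at e
        rw [e]
        split_ifs
        · exact toR_nil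
        · rw [toR_mul, diag]
      rw [coord_apply]
      simp only [bdry, Matrix.mulVecLin_apply, Matrix.mulVec, dotProduct, Matrix.of_apply,
        Finset.mul_sum, ← mul_assoc]
      rw [Finset.sum_comm]
      simp only [← Finset.sum_mul, hcol]
      split_ifs
      · simp
      · simp [coord_apply, Finset.mul_sum, mul_assoc]
    · have := bdryRank_add_le k
      rw [coord_of_le cs hi, if_neg (by omega), diag_of_le (by omega), zero_mul]
  · have := isEmpty_KW cs h (k := k + 1) (by omega)
    rw [Subsingleton.elim x 0]
    simp

end AdaptedCoordinates

section Homology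

variable {W : Type*} [Group W] {Mat : CoxeterMatrix (Fin 6)} (cs : CoxeterSystem Mat W)

theorem mem_range_bdry_iff (h : IsAffineD5 Mat) (k : ℕ) (y : KW cs k → R) :
    y ∈ LinearMap.range (bdry cs k) ↔ (∀ i < bdryRank k, coord cs k y i = 0) ∧
      ∀ j, diag (k + 1) j ∣ coord cs k y (bdryRank k + j) := by
  constructor
  · rintro ⟨x, rfl⟩
    refine ⟨fun i hi => by rw [coord_bdry cs h, if_pos hi], fun j => ?_⟩
    rw [coord_bdry cs h, if_neg (by omega), Nat.add_sub_cancel_left]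
    exact dvd_mul_right _ _
  · rintro ⟨h0, hd⟩
    choose z hz using hd
    obtain ⟨x, hx⟩ := exists_coord_eq cs h (k + 1) z
    refine ⟨x, coord_injective cs h k (funext fun i => ?_)⟩
    rw [coord_bdry cs h]
    split_ifs with hi
    · exact (h0 i hi).symm
    · obtain ⟨j, rfl⟩ := Nat.exists_eq_add_of_le (not_lt.mp hi)
      rw [Nat.add_sub_cancel_left, hz j]
      rcases lt_or_ge j (bdryRank (k + 1)) with hj | hj
      · rw [hx j (hj.trans_le (bdryRank_le (k + 1)))]
      · simp [diag_of_le hj]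

theorem mem_cycles_iff (h : IsAffineD5 Mat) (k : ℕ) (x : KW cs k → R) :
    x ∈ cycles cs k ↔ ∀ i < bdryRank k, coord cs k x i = 0 := by
  cases k with
  | zero => simp [cycles, bdryRank]
  | succ k =>
    rw [cycles, LinearMap.mem_ker]
    constructor
    · intro hx i hi
      have e := coord_bdry cs h k x (bdryRank k + i)
      rw [hx, if_neg (by omega), Nat.add_sub_cancel_left, map_zero] at e
      exact (mul_eq_zero.mp e.symm).resolve_left (diag_ne_zero hi)
    · intro hx
      refine coord_injective cs h k (funext fun i => ?_)
      rw [coord_bdry cs h, map_zero]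
      split_ifs with hi
      · rfl
      · rcases lt_or_ge (i - bdryRank k) (bdryRank (k + 1)) with hj | hj
        · rw [hx _ hj, mul_zero]; rfl
        · rw [diag_of_le hj, zero_mul]; rfl

/-- The homology in degree `k` is the target of any surjective linear map on the coordinates of
cycles whose kernel consists of the vectors divisible by the diagonal entries. -/
theorem nonempty_homology_equiv (h : IsAffineD5 Mat) (k : ℕ) {T : Type*} [AddCommGroup T]
    [Module R T] (π : (ℕ → R) →ₗ[R] T)
    (hsurj : ∀ t, ∃ y : ℕ → R, (∀ j, (codes k).length ≤ bdryRank k + j → y j = 0) ∧ π y = t)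
    (hker : ∀ y : ℕ → R, (∀ j, (codes k).length ≤ bdryRank k + j → y j = 0) →
      (π y = 0 ↔ ∀ j, diag (k + 1) j ∣ y j)) :
    Nonempty (Hgy cs k ≃ₗ[R] T) := by
  let shift : (ℕ → R) →ₗ[R] (ℕ → R) := LinearMap.funLeft R R fun j => bdryRank k + j
  let ψ : cycles cs k →ₗ[R] T := π ∘ₗ shift ∘ₗ coord cs k ∘ₗ (cycles cs k).subtype
  have hψ : Function.Surjective ψ := by
    intro t
    obtain ⟨y, hy, rfl⟩ := hsurj t
    obtain ⟨x, hx⟩ := exists_coord_eq cs h k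
      fun i => if i < bdryRank k then 0 else y (i - bdryRank k)
    have hxc : x ∈ cycles cs k := (mem_cycles_iff cs h k x).mpr fun i hi => by
      rw [hx i (hi.trans_le (bdryRank_le k)), if_pos hi]
    refine ⟨⟨x, hxc⟩, congrArg π (funext fun j => ?_)⟩
    show coord cs k x (bdryRank k + j) = y j
    rcases lt_or_ge (bdryRank k + j) (codes k).length with hj | hj
    · rw [hx _ hj, if_neg (by omega), Nat.add_sub_cancel_left]
    · rw [coord_of_le cs hj, hy j hj]
  have hkerψ : LinearMap.ker ψ =
      Submodule.comap (cycles cs k).subtype (LinearMap.range (bdry cs k)) := by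
    ext ⟨x, hx⟩
    rw [LinearMap.mem_ker, Submodule.mem_comap, Submodule.subtype_apply,
      mem_range_bdry_iff cs h, and_iff_right ((mem_cycles_iff cs h k x).mp hx)]
    exact hker _ fun j hj => coord_of_le cs hj x
  exact ⟨(Submodule.quotEquivOfEq _ _ hkerψ.symm).trans (ψ.quotKerEquivOfSurjective hψ)⟩

theorem mk_cycQuot_eq_zero_iff {d : ℕ} {x : R} :
    (Submodule.Quotient.mk x : CycQuot d) = 0 ↔ cyc d ∣ x := by
  rw [Submodule.Quotient.mk_eq_zero, Ideal.mem_span_singleton]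

theorem toR_eq_cyc {d : ℕ} {l : List ℤ} (hl : ofCoeffs l = cyclotomic d ℚ) : toR l = cyc d :=
  congrArg toLaurent hl

theorem toR_two : toR [1, 1] = cyc 2 :=
  toR_eq_cyc (by simp only [ofCoeffs, cyclotomic_two]; push_cast; ring)

theorem toR_four : toR [1, 0, 1] = cyc 4 := toR_eq_cyc (by
  have e := cyclotomic_prime_pow_eq_geom_sum (R := ℚ) (n := 1) Nat.prime_two
  norm_num [Finset.sum_range_succ] at e
  rw [e]; simp only [ofCoeffs]; push_cast; ring)

theorem toR_five : toR [1, 1, 1, 1, 1] = cyc 5 := toR_eq_cyc (by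
  have := Fact.mk Nat.prime_five
  rw [cyclotomic_prime]
  simp only [ofCoeffs, Finset.sum_range_succ, Finset.sum_range_zero]; push_cast; ring)

theorem toR_six : toR [1, -1, 1] = cyc 6 :=
  toR_eq_cyc (by simp only [ofCoeffs, cyclotomic_six]; push_cast; ring)

theorem toR_eight : toR [1, 0, 0, 0, 1] = cyc 8 := toR_eq_cyc (by
  have e := cyclotomic_prime_pow_eq_geom_sum (R := ℚ) (n := 2) Nat.prime_two
  norm_num [Finset.sum_range_succ] at e
  rw [e]; simp only [ofCoeffs]; push_cast; ring)

theorem toR_two_four_six_eight :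
    toR [1, 0, 1, 1, 1, 1, 1, 1, 0, 1] = cyc 2 * (cyc 4 * (cyc 6 * cyc 8)) := by
  rw [← toR_two, ← toR_four, ← toR_six, ← toR_eight, ← toR_mul, ← toR_mul, ← toR_mul]
  exact toR_eq_of_eqCoeffs (by decide)

theorem toR_one : toR [1] = 1 := by simp [toR]

theorem isCoprime_cyc {a b : ℕ} (hab : a ≠ b) : IsCoprime (cyc a) (cyc b) :=
  (cyclotomic.isCoprime_rat hab).map toLaurent

end Homology

section LowDegrees

variable {W : Type*} [Group W] {Mat : CoxeterMatrix (Fin 6)} (cs : CoxeterSystem Mat W)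

theorem nonempty_homology_equiv_cycQuot (h : IsAffineD5 Mat) {k d : ℕ}
    (hn : bdryRank k < (codes k).length) (h0 : diag (k + 1) 0 = cyc d)
    (h1 : ∀ j, 0 < j → bdryRank k + j < (codes k).length → diag (k + 1) j = 1) :
    Nonempty (Hgy cs k ≃ₗ[R] CycQuot d) := by
  refine nonempty_homology_equiv cs h k
    ((Ideal.span {cyc d}).mkQ ∘ₗ LinearMap.proj 0) (fun t => ?_) (fun y hy => ?_)
  · obtain ⟨x, rfl⟩ := Submodule.mkQ_surjective _ t
    exact ⟨fun j => if j = 0 then x else 0, fun j hj => if_neg (by rintro rfl; omega), rfl⟩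
  · rw [LinearMap.comp_apply, LinearMap.proj_apply, Submodule.mkQ_apply, mk_cycQuot_eq_zero_iff,
      ← h0]
    refine ⟨fun hd j => ?_, fun hd => hd 0⟩
    rcases Nat.eq_zero_or_pos j with rfl | hj
    · exact hd
    · rcases lt_or_ge (bdryRank k + j) (codes k).length with hlt | hge
      · rw [h1 j hj hlt]
        exact one_dvd _
      · rw [hy j hge]
        exact dvd_zero _

theorem subsingleton_homology_one (h : IsAffineD5 Mat) : Subsingleton (Hgy cs 1) := by
  obtain ⟨e⟩ := nonempty_homology_equiv cs h 1 (0 : (ℕ → R) →ₗ[R] PUnit)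
    (fun t => ⟨0, fun _ _ => rfl, rfl⟩) (fun y hy => by
      refine ⟨fun _ j => ?_, fun _ => rfl⟩
      rcases lt_or_ge j 5 with hj | hj
      · have : diag 2 j = 1 := by
          rw [← toR_one, diag]
          interval_cases j <;> rfl
        rw [this]
        exact one_dvd _
      · rw [hy j (by simp only [codes, bdryRank, List.length_cons, List.length_nil]; omega)]
        exact dvd_zero _)
  exact e.toEquiv.subsingleton

theorem nonempty_homology_five_equiv (h : IsAffineD5 Mat) : Nonempty (Hgy cs 5 ≃ₗ[R] R) := by
  have hlen : (codes 5).length = bdryRank 5 + 1 := rfl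
  refine nonempty_homology_equiv cs h 5 (LinearMap.proj 0) (fun t => ?_) (fun y hy => ?_)
  · exact ⟨fun j => if j = 0 then t else 0, fun j hj => if_neg (by rintro rfl; omega), rfl⟩
  · rw [LinearMap.proj_apply]
    refine ⟨fun h0 j => ?_, fun hd => by simpa [diag_of_le, bdryRank] using hd 0⟩
    rcases Nat.eq_zero_or_pos j with rfl | hj
    · rw [h0]
      exact dvd_zero _
    · rw [hy j (by omega)]
      exact dvd_zero _

theorem exists_cycQuot_mk_eq {a b : R} (hab : IsCoprime a b) (x y : R) :
    ∃ z, a ∣ z - x ∧ b ∣ z - y := by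
  obtain ⟨u, v, huv⟩ := hab
  refine ⟨u * a * y + v * b * x, ⟨u * (y - x), ?_⟩, ⟨v * (x - y), ?_⟩⟩
  · linear_combination x * huv
  · linear_combination y * huv

theorem nonempty_homology_four_equiv (h : IsAffineD5 Mat) :
    Nonempty (Hgy cs 4 ≃ₗ[R] (CycQuot 2 × CycQuot 2 × CycQuot 4 × CycQuot 6 × CycQuot 8 ×
      CycQuot 8 × CycQuot 8)) := by
  have hlen : (codes 4).length = bdryRank 4 + 5 := rfl
  have h0 : diag 5 0 = cyc 2 := toR_two
  have h1 : diag 5 1 = cyc 2 * (cyc 4 * (cyc 6 * cyc 8)) := toR_two_four_six_eight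
  have h2 : diag 5 2 = cyc 8 := toR_eight
  have h3 : diag 5 3 = cyc 8 := toR_eight
  have h4 : diag 5 4 = 1 := toR_one
  have c68 : IsCoprime (cyc 6) (cyc 8) := isCoprime_cyc (by norm_num)
  have c4 : IsCoprime (cyc 4) (cyc 6 * cyc 8) :=
    (isCoprime_cyc (by norm_num)).mul_right (isCoprime_cyc (by norm_num))
  have c2 : IsCoprime (cyc 2) (cyc 4 * (cyc 6 * cyc 8)) :=
    (isCoprime_cyc (by norm_num)).mul_right
      ((isCoprime_cyc (by norm_num)).mul_right (isCoprime_cyc (by norm_num)))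
  let q (d i : ℕ) : (ℕ → R) →ₗ[R] CycQuot d := (Ideal.span {cyc d}).mkQ ∘ₗ LinearMap.proj i
  have hq : ∀ d i y, q d i y = 0 ↔ cyc d ∣ y i := fun d i y => mk_cycQuot_eq_zero_iff
  refine nonempty_homology_equiv cs h 4 ((q 2 0).prod ((q 2 1).prod ((q 4 1).prod
    ((q 6 1).prod ((q 8 1).prod ((q 8 2).prod (q 8 3))))))) ?_ (fun y hy => ?_)
  · rintro ⟨t0, t2, t4, t6, t8, u, v⟩
    obtain ⟨x0, rfl⟩ := Submodule.mkQ_surjective _ t0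
    obtain ⟨x2, rfl⟩ := Submodule.mkQ_surjective _ t2
    obtain ⟨x4, rfl⟩ := Submodule.mkQ_surjective _ t4
    obtain ⟨x6, rfl⟩ := Submodule.mkQ_surjective _ t6
    obtain ⟨x8, rfl⟩ := Submodule.mkQ_surjective _ t8
    obtain ⟨u, rfl⟩ := Submodule.mkQ_surjective _ u
    obtain ⟨v, rfl⟩ := Submodule.mkQ_surjective _ v
    obtain ⟨z1, hz6, hz8⟩ := exists_cycQuot_mk_eq c68 x6 x8
    obtain ⟨z2, hz4, hz1⟩ := exists_cycQuot_mk_eq c4 x4 z1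
    obtain ⟨z, hz2, hz⟩ := exists_cycQuot_mk_eq c2 x2 z2
    have hz' := (dvd_mul_left _ _).trans hz
    have h4z : cyc 4 ∣ z - x4 := by
      have := ((dvd_mul_right _ _).trans hz).add hz4
      simpa using this
    have h68z : cyc 6 * cyc 8 ∣ z - z1 := by simpa using hz'.add hz1
    have h6z : cyc 6 ∣ z - x6 := by simpa using ((dvd_mul_right _ _).trans h68z).add hz6
    have h8z : cyc 8 ∣ z - x8 := by simpa using ((dvd_mul_left _ _).trans h68z).add hz8
    have hmk : ∀ {d : ℕ} {a b : R}, cyc d ∣ a - b →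
        (Ideal.span {cyc d}).mkQ a = (Ideal.span {cyc d}).mkQ b := fun hab => by
      rw [← sub_eq_zero, ← map_sub]
      exact mk_cycQuot_eq_zero_iff.mpr hab
    refine ⟨fun i => [x0, z, u, v].getD i 0, fun j hj => List.getD_eq_default _ _ ?_, ?_⟩
    · simp only [List.length_cons, List.length_nil]
      omega
    · exact Prod.ext rfl (Prod.ext (hmk hz2) (Prod.ext (hmk h4z) (Prod.ext (hmk h6z)
        (Prod.ext (hmk h8z) rfl))))
  · change (q 2 0 y, q 2 1 y, q 4 1 y, q 6 1 y, q 8 1 y, q 8 2 y, q 8 3 y) = 0 ↔ _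
    simp only [Prod.mk_eq_zero, hq]
    constructor
    · rintro ⟨d0, d2, d4, d6, d8, du, dv⟩ j
      rcases lt_or_ge j 5 with hj | hj
      · interval_cases j
        · rwa [h0]
        · rw [h1]
          exact c2.mul_dvd d2 (c4.mul_dvd d4 (c68.mul_dvd d6 d8))
        · rwa [h2]
        · rwa [h3]
        · rw [h4]
          exact one_dvd _
      · rw [hy j (by omega)]
        exact dvd_zero _
    · intro hd
      have d1 := hd 1
      rw [h1] at d1
      have d468 := (dvd_mul_left _ _).trans d1
      have d68 := (dvd_mul_left _ _).trans d468
      exact ⟨h0 ▸ hd 0, (dvd_mul_right _ _).trans d1, (dvd_mul_right _ _).trans d468,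
        (dvd_mul_right _ _).trans d68, (dvd_mul_left _ _).trans d68, h2 ▸ hd 2, h3 ▸ hd 3⟩

theorem subsingleton_homology_of_le (h : IsAffineD5 Mat) {k : ℕ} (hk : 6 ≤ k) :
    Subsingleton (Hgy cs k) := by
  have := isEmpty_KW cs h hk
  exact (Submodule.mkQ_surjective _).subsingleton

end LowDegrees

/-- Homology of the weighted complex for the affine Coxeter system of type `D̃₅`. -/
theorem homology_affine_D5 {W : Type*} [Group W] {Mat : CoxeterMatrix (Fin 6)}
    (cs : CoxeterSystem Mat W)
    (hM : ∀ i j : Fin 6, i.val < j.val →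
      Mat.M i j = (if (i.val, j.val) ∈ ([(0, 2), (1, 2), (2, 3), (3, 4), (3, 5)] : List (ℕ × ℕ)) then 3 else 2)) :
    Nonempty (Hgy cs 0 ≃ₗ[R] (CycQuot 2)) ∧
    Subsingleton (Hgy cs 1) ∧
    Nonempty (Hgy cs 2 ≃ₗ[R] (CycQuot 4)) ∧
    Nonempty (Hgy cs 3 ≃ₗ[R] (CycQuot 5)) ∧
    Nonempty (Hgy cs 4 ≃ₗ[R] (CycQuot 2 × CycQuot 2 × CycQuot 4 × CycQuot 6 × CycQuot 8 × CycQuot 8 × CycQuot 8)) ∧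
    Nonempty (Hgy cs 5 ≃ₗ[R] R) ∧
    (∀ k, 6 ≤ k → Subsingleton (Hgy cs k)) := by
  have h := isAffineD5_of_lt hM
  refine ⟨?_, subsingleton_homology_one cs h, ?_, ?_, nonempty_homology_four_equiv cs h,
    nonempty_homology_five_equiv cs h, fun k hk => subsingleton_homology_of_le cs h hk⟩
  · refine nonempty_homology_equiv_cycQuot cs h (by decide) toR_two fun j hj hj' => ?_
    simp only [codes, bdryRank, List.length_cons, List.length_nil] at hj'
    omega
  · refine nonempty_homology_equiv_cycQuot cs h (by decide) toR_four fun j hj hj' => ?_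
    have hlen : (codes 2).length = bdryRank 2 + 10 := rfl
    have hj10 : j < 10 := by omega
    rw [← toR_one, diag]
    interval_cases j <;> rfl
  · refine nonempty_homology_equiv_cycQuot cs h (by decide) toR_five fun j hj hj' => ?_
    have hlen : (codes 3).length = bdryRank 3 + 10 := rfl
    have hj10 : j < 10 := by omega
    rw [← toR_one, diag]
    interval_cases j <;> rfl
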